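/- arXiv:1806.08291 — 3 statements merged into one kernel-verified Lean document; each statement's English description precedes it below -/
import Mathlib

section
/- Let G be a spider with body v, and let I and J be independent sets of G with |I| = |J| such that I ↭ J, no token of I is (G,I)-rigid, and no token of J is (G,J)-rigid. Suppose that |I ∩ N(v)| ≤ 1 and |J ∩ N(v)| ≤ 1, that some leg L′ of G satisfies |I_{L′}| ≠ |J_{L′}|, and that I ∩ N(v) = {x} and J ∩ N(v) = {y} where x and y lie in the same leg L of G with |I_L| = |J_L| (so that x = y). Then every TS-sequence S between I and J satisfies D_G(S) ≥ 2 (hence D*(G,I,J) ≥ 2), and there exists a TS-sequence between I and J of length M*(G,I,J) + 2. -/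
/-!
Common definitions for formalizing "Shortest Reconfiguration Sequence for
Sliding Tokens on Spiders" (Hoang, Khorramian, Uehara).
-/

namespace SlidingTokenPaper

variable {V : Type*} [Fintype V] [DecidableEq V]

/-- A finite vertex set is independent in `G`. -/
def IsIndep (G : SimpleGraph V) (I : Finset V) : Prop :=
  ∀ x ∈ I, ∀ y ∈ I, ¬ G.Adj x y

/-- One token slide: a token moves from `x` to `y` along an edge `xy`. -/
def Step (G : SimpleGraph V) (A B : Finset V) : Prop :=
  ∃ x y : V, G.Adj x y ∧ A \ B = {x} ∧ B \ A = {y}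

/-- `S` is a TS-sequence between the independent sets `I` and `J` of `G`. -/
def IsTSSeq (G : SimpleGraph V) (I J : Finset V) (S : List (Finset V)) : Prop :=
  S ≠ [] ∧ S.head? = some I ∧ S.getLast? = some J ∧
  (∀ A ∈ S, IsIndep G A ∧ A.card = I.card) ∧ List.Chain' (Step G) S

/-- The length of a TS-sequence: number of token slides. -/
def len (S : List (Finset V)) : ℕ := S.length - 1

/-- `I ↭ J`: there is a TS-sequence between `I` and `J`. -/
def Reconf (G : SimpleGraph V) (I J : Finset V) : Prop :=
  ∃ S, IsTSSeq G I J S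

/-- `M*(G,I,J)`: the minimum over all bijections (target assignments)
`f : I → J` of `∑_{w ∈ I} dist_G(w, f(w))`. -/
noncomputable def Mstar (G : SimpleGraph V) (I J : Finset V) : ℕ :=
  sInf { m : ℕ | ∃ e : {x // x ∈ I} ≃ {y // y ∈ J},
    m = ∑ x : {x // x ∈ I}, G.dist (x : V) ((e x : V)) }

/-- The number of occurrences of the move `x → y` in `S`. -/
def moveCount (S : List (Finset V)) (x y : V) : ℕ :=
  ((S.zip S.tail).filter fun p => p.1 \ p.2 = {x} ∧ p.2 \ p.1 = {y}).length

/-- `D_G(S, e)`: twice the minimum of the numbers of occurrences of the moves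
`x → y` and `y → x` in `S`, where `e = xy`. -/
def detours (S : List (Finset V)) : Sym2 V → ℕ :=
  Sym2.lift ⟨fun x y => 2 * min (moveCount S x y) (moveCount S y x),
    fun x y => by dsimp only; rw [min_comm]⟩

open scoped Classical in
/-- `D_G(S)`: the total number of detours `S` makes, summed over the edges. -/
noncomputable def totalDetours (G : SimpleGraph V) (S : List (Finset V)) : ℕ :=
  ∑ e ∈ Finset.univ.filter (· ∈ G.edgeSet), detours S e

/-- `D*(G,I,J)`: the minimum number of detours of a TS-sequence between `I` and `J`. -/
noncomputable def Dstar (G : SimpleGraph V) (I J : Finset V) : ℕ :=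
  sInf { d : ℕ | ∃ S, IsTSSeq G I J S ∧ d = totalDetours G S }

/-- The token on `u ∈ I` is `(G, I)`-rigid: `u` belongs to every independent set
reachable from `I`. -/
def RigidToken (G : SimpleGraph V) (I : Finset V) (u : V) : Prop :=
  ∀ I', Reconf G I I' → u ∈ I'

/-- `G` is a spider with body `v`: a tree with exactly one vertex of degree ≥ 3. -/
def IsSpider (G : SimpleGraph V) (v : V) : Prop :=
  G.IsTree ∧ 3 ≤ (G.neighborSet v).ncard ∧ ∀ w, 3 ≤ (G.neighborSet w).ncard → w = v

/-- For adjacent `x, y` in a tree `T`, `side T x y` is the vertex set of `T^x_y`,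
the component of `T − xy` containing `y` (vertices strictly closer to `y` than to `x`). -/
def side (G : SimpleGraph V) (x y : V) : Set V :=
  {z | G.dist z y < G.dist z x}

/-- `|I ∩ V(L)|` for the leg `L` of the spider with body `v` containing the
neighbor `w` of `v`. -/
noncomputable def legCard (G : SimpleGraph V) (I : Finset V) (v w : V) : ℕ :=
  ((I : Set V) ∩ side G v w).ncard

/-- `|I ∩ V(L)| − |J ∩ V(L)|` for the leg `L` of the spider indexed by the
neighbor `w` of the body `v`. -/
noncomputable def legDiff (G : SimpleGraph V) (I J : Finset V) (v w : V) : ℤ :=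
  (legCard G I v w : ℤ) - (legCard G J v w : ℤ)

/-- The leg indexed by the neighbor `w₁` of `v` may serve as `L_1` in a labeling
of the legs making `|I∩V(L_i)| − |J∩V(L_i)|` nondecreasing, i.e. it minimizes the
difference. -/
def IsFirstLeg (G : SimpleGraph V) (I J : Finset V) (v w₁ : V) : Prop :=
  G.Adj v w₁ ∧ ∀ w, G.Adj v w → legDiff G I J v w₁ ≤ legDiff G I J v w

/-- `I_L` for the leg `L` indexed by the neighbor `w` of the body `v`, where the
first leg (indexed by `w₁`) additionally receives `I ∩ {v}`. -/
noncomputable def ILeg (G : SimpleGraph V) (I : Finset V) (v w₁ w : V) : Set V :=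
  ((I : Set V) ∩ side G v w) ∪ (if w = w₁ then (I : Set V) ∩ {v} else ∅)

/-- `|I_L|` for the leg `L` indexed by the neighbor `w` of the body `v`. -/
noncomputable def ILegCard (G : SimpleGraph V) (I : Finset V) (v w₁ w : V) : ℕ :=
  (ILeg G I v w₁ w).ncard

/-- `S` makes a detour over the edge `ab`: both moves `a → b` and `b → a` occur in `S`. -/
def MakesDetour (S : List (Finset V)) (a b : V) : Prop :=
  0 < moveCount S a b ∧ 0 < moveCount S b a


set_option linter.unusedSectionVars false

/-- In a tree, a vertex other than the root has only one neighbor closer to the root. -/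
theorem unique_closer_neighbor {G : SimpleGraph V} (hG : G.IsTree) {r u a b : V}
    (ha : G.Adj u a) (hb : G.Adj u b) (hda : G.dist r u = G.dist r a + 1)
    (hdb : G.dist r u = G.dist r b + 1) : a = b := by
  obtain ⟨p, hp, hpl⟩ := hG.connected.exists_path_of_dist r a
  obtain ⟨q, hq, hql⟩ := hG.connected.exists_path_of_dist r b
  have hp' : (p.concat ha.symm).IsPath :=
    SimpleGraph.Walk.isPath_of_length_eq_dist _ (by simp [hpl, hda])
  have hq' : (q.concat hb.symm).IsPath :=
    SimpleGraph.Walk.isPath_of_length_eq_dist _ (by simp [hql, hdb])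
  have h := (hG.existsUnique_path r u).unique hp' hq'
  have h2 := congrArg SimpleGraph.Walk.penultimate h
  simpa using h2

/-- In a connected graph, a vertex other than the root has a neighbor closer to the root. -/
theorem exists_closer_neighbor {G : SimpleGraph V} (hG : G.Connected) {r u : V} (h : u ≠ r) :
    ∃ p, G.Adj u p ∧ G.dist r u = G.dist r p + 1 := by
  obtain ⟨p, hp⟩ := hG.exists_walk_length_eq_dist u r
  cases p with
  | nil => exact absurd rfl h
  | @cons _ b _ hab q =>
    refine ⟨b, hab, ?_⟩
    have h1 : G.dist b r ≤ q.length := SimpleGraph.dist_le q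
    have h2 : G.dist u r ≤ G.dist u b + G.dist b r := hG.dist_triangle
    have h3 : G.dist u b = 1 := SimpleGraph.dist_eq_one_iff_adj.2 hab
    rw [SimpleGraph.Walk.length_cons] at hp
    rw [G.dist_comm (u := r) (v := u), G.dist_comm (u := r) (v := b)]
    omega

/-- Coordinates on a spider with body `v`: every vertex is determined by its depth `d` (distance
to the body) together with the neighbor `leg` of the body through which it is reached. -/
structure SpiderCoords (G : SimpleGraph V) (v : V) (d : V → ℕ) (leg : V → V) : Prop where
  depth_eq_zero : ∀ u, d u = 0 ↔ u = v
  leg_body : leg v = v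
  adj_leg : ∀ u, u ≠ v → G.Adj v (leg u)
  leg_of_adj : ∀ w, G.Adj v w → leg w = w
  ext : ∀ a b, leg a = leg b → d a = d b → a = b
  adj_iff : ∀ a b, G.Adj a b ↔
    (d b = d a + 1 ∧ (a = v ∨ leg a = leg b)) ∨ (d a = d b + 1 ∧ (b = v ∨ leg a = leg b))
  exists_parent : ∀ u, u ≠ v → ∃ p, d u = d p + 1 ∧ (p = v ∨ leg p = leg u)
  mem_side : ∀ w z, G.Adj v w → (z ∈ side G v w ↔ leg z = w)

theorem IsSpider.exists_coords {G : SimpleGraph V} {v : V} (hG : IsSpider G v) :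
    ∃ d leg, SpiderCoords G v d leg := by
  obtain ⟨hT, -, hdeg⟩ := hG
  have hC := hT.connected
  have hex : ∀ u, ∃ w, (u = v → w = v) ∧
      (u ≠ v → G.Adj v w ∧ G.dist u v = G.dist u w + 1) := by
    intro u
    by_cases hu : u = v
    · exact ⟨v, fun _ => rfl, fun h => absurd hu h⟩
    · obtain ⟨p, hp⟩ := exists_closer_neighbor hC (r := u) (u := v) (Ne.symm hu)
      exact ⟨p, fun h => absurd h hu, fun _ => hp⟩
  choose leg hlegv hleg using hex
  have hd0 : ∀ u, G.dist v u = 0 ↔ u = v := fun u => by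
    rw [hC.dist_eq_zero_iff, eq_comm]
  have hadj : ∀ a b, G.Adj a b → G.dist v b = G.dist v a + 1 ∨ G.dist v a = G.dist v b + 1 := by
    intro a b h
    have := hT.dist_eq_dist_add_one_of_adj v h
    tauto
  have huniq : ∀ u w, u ≠ v → G.Adj v w → G.dist u w < G.dist u v → leg u = w := by
    intro u w hu hw hlt
    obtain ⟨h1, h2⟩ := hleg u hu
    refine unique_closer_neighbor hT h1 hw h2 ?_
    have := hT.dist_eq_dist_add_one_of_adj u hw
    omega
  have hlegadj : ∀ a b, a ≠ v → G.Adj a b → G.dist v b = G.dist v a + 1 → leg b = leg a := by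
    intro a b ha hab hd
    obtain ⟨h1, h2⟩ := hleg a ha
    have hb : b ≠ v := fun h => by rw [← hd0] at h; omega
    refine huniq b _ hb h1 ?_
    have h3 : G.dist b (leg a) ≤ G.dist b a + G.dist a (leg a) := hC.dist_triangle
    have h4 : G.dist b a = 1 := SimpleGraph.dist_eq_one_iff_adj.2 hab.symm
    rw [G.dist_comm (u := b) (v := v)]
    rw [G.dist_comm (u := a) (v := v)] at h2
    omega
  have hpar : ∀ u, u ≠ v → ∃ p, G.Adj u p ∧ G.dist v u = G.dist v p + 1 ∧
      (p = v ∨ leg p = leg u) := by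
    intro u hu
    obtain ⟨p, hp, hdp⟩ := exists_closer_neighbor hC hu
    refine ⟨p, hp, hdp, ?_⟩
    by_cases hpv : p = v
    · exact Or.inl hpv
    · exact Or.inr (hlegadj p u hpv hp.symm hdp).symm
  have hlegw : ∀ w, G.Adj v w → leg w = w := fun w hw =>
    huniq w w hw.ne' hw (by
      rw [SimpleGraph.dist_self, G.dist_comm, SimpleGraph.dist_eq_one_iff_adj.2 hw]; omega)
  have hlegne : ∀ u, u ≠ v → leg u ≠ v := fun u hu => (hleg u hu).1.ne'
  have hext : ∀ n, ∀ a b, leg a = leg b → G.dist v a = n → G.dist v b = n → a = b := by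
    intro n
    induction n with
    | zero => intro a b _ ha hb; rw [hd0] at ha hb; rw [ha, hb]
    | succ n ih =>
      intro a b hab ha hb
      have hav : a ≠ v := fun h => by rw [← hd0] at h; omega
      have hbv : b ≠ v := fun h => by rw [← hd0] at h; omega
      obtain ⟨p, hp, hdp, hlp⟩ := hpar a hav
      obtain ⟨q, hq, hdq, hlq⟩ := hpar b hbv
      by_cases hn : n = 0
      · have h1 : G.dist v a = 1 := by omega
        have h2 : G.dist v b = 1 := by omega
        rw [SimpleGraph.dist_eq_one_iff_adj] at h1 h2
        rw [← hlegw a h1, ← hlegw b h2, hab]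
      · have hpv : p ≠ v := fun h => by rw [← hd0] at h; omega
        have hqv : q ≠ v := fun h => by rw [← hd0] at h; omega
        have hpq : p = q := ih p q (by
          rw [hlp.resolve_left hpv, hlq.resolve_left hqv, hab]) (by omega) (by omega)
        subst hpq
        obtain ⟨g, hg, hdg, -⟩ := hpar p hpv
        by_contra hne
        refine hpv (hdeg p ?_)
        have hsub : (({a, b, g} : Finset V) : Set V) ⊆ G.neighborSet p := by
          intro z hz
          simp only [Finset.coe_insert, Finset.coe_singleton, Set.mem_insert_iff,
            Set.mem_singleton_iff] at hz
          rcases hz with rfl | rfl | rfl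
          · exact hp.symm
          · exact hq.symm
          · exact hg
        have hcard : ({a, b, g} : Finset V).card = 3 := by
          refine Finset.card_eq_three.2 ⟨a, b, g, hne, ?_, ?_, rfl⟩
          · rintro rfl; omega
          · rintro rfl; omega
        rw [← hcard, ← Set.ncard_coe_finset]
        exact Set.ncard_le_ncard hsub (Set.toFinite _)
  refine ⟨G.dist v, leg, ⟨hd0, hlegv v rfl, fun u hu => (hleg u hu).1, hlegw,
    fun a b h1 h2 => hext _ a b h1 h2 rfl, ?_, ?_, ?_⟩⟩
  · intro a b
    have key : ∀ a b, G.dist v b = G.dist v a + 1 → (a = v ∨ leg a = leg b) → G.Adj a b := by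
      intro a b hd h
      have hb : b ≠ v := fun h => by rw [← hd0] at h; omega
      obtain ⟨p, hp, hdp, hlp⟩ := hpar b hb
      have hpa : p = a := by
        by_cases hav : a = v
        · rw [← hd0] at hav
          rw [(hd0 a).1 hav, (hd0 p).1 (by omega)]
        · have hpv : p ≠ v := fun h => hav ((hd0 a).1 (by rw [← hd0] at h; omega))
          exact hext _ p a (by rw [hlp.resolve_left hpv, h.resolve_left hav]) rfl (by omega)
      rw [← hpa]; exact hp.symm
    constructor
    · intro h
      rcases hadj a b h with h' | h'
      · refine Or.inl ⟨h', ?_⟩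
        by_cases hav : a = v
        · exact Or.inl hav
        · exact Or.inr (hlegadj a b hav h h').symm
      · refine Or.inr ⟨h', ?_⟩
        by_cases hbv : b = v
        · exact Or.inl hbv
        · exact Or.inr (hlegadj b a hbv h.symm h')
    · rintro (⟨h1, h2⟩ | ⟨h1, h2⟩)
      · exact key a b h1 h2
      · exact (key b a h1 (h2.imp id Eq.symm)).symm
  · intro u hu
    obtain ⟨p, -, h⟩ := hpar u hu
    exact ⟨p, h⟩
  · intro w z hw
    change G.dist z w < G.dist z v ↔ _
    constructor
    · intro h
      refine huniq z w ?_ hw h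
      rintro rfl
      rw [SimpleGraph.dist_self] at h
      omega
    · rintro rfl
      have hz : z ≠ v := by
        rintro rfl
        rw [hlegv z rfl] at hw
        exact hw.ne rfl
      rw [(hleg z hz).2]
      omega

/-- The number of vertices of `A` on the leg `l` at depth at least `j`. -/
def legCount (d : V → ℕ) (leg : V → V) (A : Finset V) (l : V) (j : ℕ) : ℕ :=
  (A.filter fun z => leg z = l ∧ j ≤ d z).card

/-- The total net number of tokens that have to cross the edges of the spider to get
from `A` to `B`; the edge from `u` to its parent is indexed by `u`. -/
def flow (d : V → ℕ) (leg : V → V) (v : V) (A B : Finset V) : ℕ :=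
  ∑ u ∈ Finset.univ.erase v,
    ((legCount d leg A (leg u) (d u) : ℤ) - legCount d leg B (leg u) (d u)).natAbs

namespace SpiderCoords

variable {G : SimpleGraph V} {v : V} {d : V → ℕ} {leg : V → V}

theorem depth_pos (h : SpiderCoords G v d leg) {u : V} (hu : u ≠ v) : 1 ≤ d u :=
  Nat.one_le_iff_ne_zero.2 fun h0 => hu ((h.depth_eq_zero u).1 h0)

theorem ne_body (h : SpiderCoords G v d leg) {u : V} (hu : 1 ≤ d u) : u ≠ v := fun h' => by
  rw [← h.depth_eq_zero] at h'; omega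

theorem depth_body (h : SpiderCoords G v d leg) : d v = 0 := (h.depth_eq_zero v).2 rfl

theorem adj_body_iff (h : SpiderCoords G v d leg) {u : V} : G.Adj v u ↔ d u = 1 := by
  rw [h.adj_iff, h.depth_body]
  constructor
  · rintro (⟨h1, -⟩ | ⟨h1, -⟩) <;> omega
  · intro h1; exact Or.inl ⟨by omega, Or.inl rfl⟩

theorem adj_parent (h : SpiderCoords G v d leg) {p u : V} (hd : d u = d p + 1)
    (hl : p = v ∨ leg p = leg u) : G.Adj p u :=
  (h.adj_iff p u).2 (Or.inl ⟨hd, hl⟩)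

theorem legCount_of_mem (h : SpiderCoords G v d leg) {A : Finset V} {u : V} (hu : u ∈ A) :
    legCount d leg A (leg u) (d u) = legCount d leg A (leg u) (d u + 1) + 1 := by
  unfold legCount
  rw [← Finset.card_insert_of_notMem (a := u) (by simp)]
  congr 1
  ext z
  simp only [Finset.mem_filter, Finset.mem_insert]
  constructor
  · rintro ⟨h1, h2, h3⟩
    by_cases hz : d z = d u
    · exact Or.inl (h.ext _ _ h2 hz)
    · exact Or.inr ⟨h1, h2, by omega⟩
  · rintro (rfl | ⟨h1, h2, h3⟩)
    · exact ⟨hu, rfl, le_rfl⟩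
    · exact ⟨h1, h2, by omega⟩

theorem legCount_of_notMem (h : SpiderCoords G v d leg) {A : Finset V} {u : V} (hu : u ∉ A) :
    legCount d leg A (leg u) (d u) = legCount d leg A (leg u) (d u + 1) := by
  unfold legCount
  congr 1
  ext z
  simp only [Finset.mem_filter]
  constructor
  · rintro ⟨h1, h2, h3⟩
    refine ⟨h1, h2, ?_⟩
    have hz : d z ≠ d u := fun hz => hu (h.ext _ _ h2 hz ▸ h1)
    omega
  · rintro ⟨h1, h2, h3⟩
    exact ⟨h1, h2, by omega⟩

theorem legCount_bounds (h : SpiderCoords G v d leg) (A : Finset V) (u : V) :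
    legCount d leg A (leg u) (d u + 1) ≤ legCount d leg A (leg u) (d u) ∧
    legCount d leg A (leg u) (d u) ≤ legCount d leg A (leg u) (d u + 1) + 1 := by
  by_cases hu : u ∈ A
  · have := h.legCount_of_mem hu; omega
  · have := h.legCount_of_notMem hu; omega

theorem exists_of_le_depth (h : SpiderCoords G v d leg) {j : ℕ} (hj : 1 ≤ j) (z : V)
    (hz : j ≤ d z) : ∃ u, u ≠ v ∧ leg u = leg z ∧ d u = j := by
  induction hn : d z - j generalizing z with
  | zero => exact ⟨z, h.ne_body (by omega), rfl, by omega⟩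
  | succ n ih =>
    obtain ⟨p, hp, hl⟩ := h.exists_parent z (h.ne_body (by omega))
    obtain ⟨u, hu, hlu, hdu⟩ := ih p (by omega) (by omega)
    exact ⟨u, hu, hlu.trans (hl.resolve_left (h.ne_body (by omega))), hdu⟩

theorem exists_of_legCount_pos (h : SpiderCoords G v d leg) {A : Finset V} {l : V} {j : ℕ}
    (hj : 1 ≤ j) (hpos : 0 < legCount d leg A l j) : ∃ u, u ≠ v ∧ leg u = l ∧ d u = j := by
  obtain ⟨z, hz⟩ := Finset.card_pos.1 hpos
  obtain ⟨-, h2, h3⟩ := Finset.mem_filter.1 hz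
  obtain ⟨u, hu, hlu, hdu⟩ := h.exists_of_le_depth hj z h3
  exact ⟨u, hu, hlu.trans h2, hdu⟩

theorem sum_legCount [DecidableRel G.Adj] (h : SpiderCoords G v d leg) (A : Finset V) :
    ∑ w ∈ Finset.univ.filter (G.Adj v), legCount d leg A w 1 = (A.erase v).card := by
  rw [Finset.card_eq_sum_card_fiberwise (f := leg) (t := Finset.univ.filter (G.Adj v))]
  · refine Finset.sum_congr rfl fun w hw => ?_
    unfold legCount
    congr 1
    ext z
    simp only [Finset.mem_filter, Finset.mem_erase, Finset.mem_univ, true_and] at hw ⊢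
    constructor
    · rintro ⟨h1, h2, h3⟩
      exact ⟨⟨h.ne_body h3, h1⟩, h2⟩
    · rintro ⟨⟨h1, h2⟩, h3⟩
      exact ⟨h2, h3, h.depth_pos h1⟩
  · intro z hz
    simp only [Finset.coe_erase, Set.mem_sdiff, Set.mem_singleton_iff, Finset.mem_coe] at hz
    simpa using h.adj_leg z hz.2

/-- Sliding a token from `p` to its child `u` changes the count below `u` only. -/
theorem legCount_slide (h : SpiderCoords G v d leg) {A : Finset V} {p u : V}
    (hd : d u = d p + 1) (hl : p = v ∨ leg p = leg u) (hp : p ∈ A) (hu : u ∉ A)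
    {z : V} (hz : z ≠ v) :
    legCount d leg (insert u (A.erase p)) (leg z) (d z) =
      legCount d leg A (leg z) (d z) + if z = u then 1 else 0 := by
  unfold legCount
  have hpu : u ∉ A.erase p := fun h' => hu (Finset.mem_of_mem_erase h')
  rw [Finset.card_filter, Finset.card_filter, Finset.sum_insert hpu,
    ← Finset.add_sum_erase A _ hp]
  have key : (if leg u = leg z ∧ d z ≤ d u then 1 else 0) =
      (if leg p = leg z ∧ d z ≤ d p then 1 else 0) + (if z = u then 1 else 0) := by
    have hzpos := h.depth_pos hz
    by_cases hzu : z = u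
    · subst hzu
      have : ¬ (d z ≤ d p) := by omega
      simp [this]
    · have : (leg u = leg z ∧ d z ≤ d u) ↔ (leg p = leg z ∧ d z ≤ d p) := by
        constructor
        · rintro ⟨h1, h2⟩
          have hne : d z ≠ d u := fun h' => hzu (h.ext _ _ h1.symm h')
          have hpv : p ≠ v := h.ne_body (by omega)
          exact ⟨(hl.resolve_left hpv).trans h1, by omega⟩
        · rintro ⟨h1, h2⟩
          have hpv : p ≠ v := h.ne_body (by omega)
          exact ⟨(hl.resolve_left hpv).symm.trans h1, by omega⟩
      simp [this, hzu]
  omega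

theorem flow_slide_out (h : SpiderCoords G v d leg) {A B : Finset V} {p u : V}
    (hd : d u = d p + 1) (hl : p = v ∨ leg p = leg u) (hp : p ∈ A) (hu : u ∉ A)
    (hlt : legCount d leg A (leg u) (d u) < legCount d leg B (leg u) (d u)) :
    flow d leg v (insert u (A.erase p)) B + 1 = flow d leg v A B := by
  have huv : u ≠ v := h.ne_body (by omega)
  unfold flow
  have hmem : u ∈ Finset.univ.erase v := Finset.mem_erase.2 ⟨huv, Finset.mem_univ u⟩
  rw [← Finset.add_sum_erase _ _ hmem, ← Finset.add_sum_erase _ _ hmem,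
    h.legCount_slide hd hl hp hu huv, if_pos rfl]
  have : ∀ z ∈ (Finset.univ.erase v).erase u,
      ((legCount d leg (insert u (A.erase p)) (leg z) (d z) : ℤ) -
        legCount d leg B (leg z) (d z)).natAbs =
      ((legCount d leg A (leg z) (d z) : ℤ) - legCount d leg B (leg z) (d z)).natAbs := by
    intro z hz
    simp only [Finset.mem_erase, Finset.mem_univ, and_true] at hz
    rw [h.legCount_slide hd hl hp hu hz.2, if_neg hz.1, add_zero]
  rw [Finset.sum_congr rfl this]
  push_cast
  omega

theorem flow_slide_in (h : SpiderCoords G v d leg) {A B : Finset V} {p u : V}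
    (hd : d u = d p + 1) (hl : p = v ∨ leg p = leg u) (hp : p ∉ A) (hu : u ∈ A)
    (hlt : legCount d leg B (leg u) (d u) < legCount d leg A (leg u) (d u)) :
    flow d leg v (insert p (A.erase u)) B + 1 = flow d leg v A B := by
  have huv : u ≠ v := h.ne_body (by omega)
  have hpu : p ≠ u := by rintro rfl; omega
  have hback : insert u ((insert p (A.erase u)).erase p) = A := by
    rw [Finset.erase_insert (fun h' => hp (Finset.mem_of_mem_erase h')),
      Finset.insert_erase hu]
  have hcount : ∀ z, z ≠ v → legCount d leg A (leg z) (d z) =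
      legCount d leg (insert p (A.erase u)) (leg z) (d z) + if z = u then 1 else 0 := by
    intro z hz
    have := h.legCount_slide (A := insert p (A.erase u)) hd hl (Finset.mem_insert_self _ _)
      (by simp [hpu.symm]) hz
    rwa [hback] at this
  unfold flow
  have hmem : u ∈ Finset.univ.erase v := Finset.mem_erase.2 ⟨huv, Finset.mem_univ u⟩
  rw [← Finset.add_sum_erase _ _ hmem, ← Finset.add_sum_erase _ _ hmem]
  have : ∀ z ∈ (Finset.univ.erase v).erase u,
      ((legCount d leg (insert p (A.erase u)) (leg z) (d z) : ℤ) -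
        legCount d leg B (leg z) (d z)).natAbs =
      ((legCount d leg A (leg z) (d z) : ℤ) - legCount d leg B (leg z) (d z)).natAbs := by
    intro z hz
    simp only [Finset.mem_erase, Finset.mem_univ, and_true] at hz
    rw [hcount z hz.2, if_neg hz.1, add_zero]
  rw [Finset.sum_congr rfl this]
  have := hcount u huv
  rw [if_pos rfl] at this
  omega

end SpiderCoords

theorem step_slide {G : SimpleGraph V} {A : Finset V} {a b : V} (hab : G.Adj a b) (ha : a ∈ A)
    (hb : b ∉ A) : Step G A (insert b (A.erase a)) := by
  have hne := hab.ne
  refine ⟨a, b, hab, ?_, ?_⟩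
  · ext z
    simp only [Finset.mem_sdiff, Finset.mem_insert, Finset.mem_erase, Finset.mem_singleton]
    constructor
    · rintro ⟨h1, h2⟩
      by_contra h3
      exact h2 (Or.inr ⟨h3, h1⟩)
    · rintro rfl
      exact ⟨ha, by simp [hne]⟩
  · ext z
    simp only [Finset.mem_sdiff, Finset.mem_insert, Finset.mem_erase, Finset.mem_singleton]
    constructor
    · rintro ⟨h1 | ⟨-, h1⟩, h2⟩
      · exact h1
      · exact absurd h1 h2
    · rintro rfl
      exact ⟨Or.inl rfl, hb⟩

theorem card_slide {A : Finset V} {a b : V} (ha : a ∈ A) (hb : b ∉ A) :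
    (insert b (A.erase a)).card = A.card := by
  rw [Finset.card_insert_of_notMem (fun h => hb (Finset.mem_of_mem_erase h)),
    Finset.card_erase_add_one ha]

theorem IsIndep.slide {G : SimpleGraph V} {A : Finset V} {a b : V} (hA : IsIndep G A)
    (hfree : ∀ z ∈ A, G.Adj b z → z = a) : IsIndep G (insert b (A.erase a)) := by
  intro x hx y hy hxy
  rw [Finset.mem_insert, Finset.mem_erase] at hx hy
  rcases hx with rfl | ⟨hx, hxA⟩ <;> rcases hy with rfl | ⟨hy, hyA⟩
  · exact hxy.ne rfl
  · exact hy (hfree y hyA hxy)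
  · exact hx (hfree x hxA hxy.symm)
  · exact hA x hxA y hyA hxy

namespace SpiderCoords

variable {G : SimpleGraph V} {v : V} {d : V → ℕ} {leg : V → V}

/-- If the count below `u` falls short of that of `B` and the parent of `u` carries a token,
then some token can slide away from the body over an edge where tokens are lacking. -/
theorem exists_slide_out (h : SpiderCoords G v d leg) {A B : Finset V} (hA : IsIndep G A)
    (hB : IsIndep G B)
    (hex : ∃ p u, d u = d p + 1 ∧ (p = v ∨ leg p = leg u) ∧ p ∈ A ∧
      legCount d leg A (leg u) (d u) < legCount d leg B (leg u) (d u)) :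
    ∃ p u, d u = d p + 1 ∧ (p = v ∨ leg p = leg u) ∧ p ∈ A ∧
      legCount d leg A (leg u) (d u) < legCount d leg B (leg u) (d u) ∧
      ∀ z ∈ A, G.Adj u z → z = p := by
  classical
  let T : Finset V := Finset.univ.filter fun u => ∃ p, d u = d p + 1 ∧ (p = v ∨ leg p = leg u) ∧
    p ∈ A ∧ legCount d leg A (leg u) (d u) < legCount d leg B (leg u) (d u)
  have hT : T.Nonempty := by
    obtain ⟨p, u, hu⟩ := hex
    exact ⟨u, by simp only [T, Finset.mem_filter, Finset.mem_univ, true_and]; exact ⟨p, hu⟩⟩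
  obtain ⟨u, huT, hmax⟩ := T.exists_max_image d hT
  obtain ⟨p, hd, hl, hp, hlt⟩ := (Finset.mem_filter.1 huT).2
  refine ⟨p, u, hd, hl, hp, hlt, fun c hc huc => ?_⟩
  have huv : u ≠ v := h.ne_body (by omega)
  rcases (h.adj_iff u c).1 huc with ⟨hdc, hlc⟩ | ⟨hdc, hlc⟩
  · exfalso
    have hlc := hlc.resolve_left huv
    have huA : u ∉ A := fun hu => hA u hu c hc huc
    have h1 := h.legCount_of_notMem huA
    have h2 := h.legCount_of_mem hc
    have h3 : legCount d leg B (leg u) (d u) ≤ legCount d leg B (leg u) (d u + 1 + 1) + 1 := by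
      have b1 := h.legCount_bounds B u
      have b2 := h.legCount_bounds B c
      by_cases huB : u ∈ B
      · have hcB : c ∉ B := fun hcB => hB u huB c hcB huc
        have := h.legCount_of_notMem hcB
        rw [← hlc, hdc] at this
        omega
      · have := h.legCount_of_notMem huB
        rw [← hlc, hdc] at b2
        omega
    rw [← hlc, hdc] at h2
    obtain ⟨c', hc'v, hlc', hdc'⟩ := h.exists_of_legCount_pos (A := B) (l := leg u)
      (j := d u + 1 + 1) (by omega) (by omega)
    have hc'T : c' ∈ T := by
      simp only [T, Finset.mem_filter, Finset.mem_univ, true_and]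
      refine ⟨c, by omega, Or.inr (by rw [hlc', hlc]), hc, ?_⟩
      rw [hlc', hdc']
      omega
    have := hmax c' hc'T
    omega
  · have hpp : c = v ∨ leg c = leg u := hlc.imp id Eq.symm
    by_cases hpv : p = v
    · have : d p = 0 := (h.depth_eq_zero p).2 hpv
      rw [hpv, ← h.depth_eq_zero]; omega
    · have := h.depth_pos hpv
      exact h.ext _ _ ((hpp.resolve_left (h.ne_body (by omega))).trans
        (hl.resolve_left hpv).symm) (by omega)

/-- If the count below some token of `A` exceeds that of `B`, then some such token is obstructed
from sliding towards the body at most by the body itself. -/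
theorem exists_slide_in (h : SpiderCoords G v d leg) {A B : Finset V} (hA : IsIndep G A)
    (hB : IsIndep G B)
    (hex : ∃ u, u ≠ v ∧ u ∈ A ∧
      legCount d leg B (leg u) (d u) < legCount d leg A (leg u) (d u)) :
    ∃ p u, d u = d p + 1 ∧ (p = v ∨ leg p = leg u) ∧ u ∈ A ∧
      legCount d leg B (leg u) (d u) < legCount d leg A (leg u) (d u) ∧
      (p ≠ v → ∀ z ∈ A, G.Adj p z → z = u ∨ z = v) := by
  classical
  let T : Finset V := Finset.univ.filter fun u => u ≠ v ∧ u ∈ A ∧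
      legCount d leg B (leg u) (d u) < legCount d leg A (leg u) (d u)
  have hT : T.Nonempty := by
    obtain ⟨u, hu⟩ := hex
    exact ⟨u, by simpa [T] using hu⟩
  obtain ⟨u, huT, hmin⟩ := T.exists_min_image d hT
  obtain ⟨huv, huA, hlt⟩ := (Finset.mem_filter.1 huT).2
  obtain ⟨p, hd, hl⟩ := h.exists_parent u huv
  refine ⟨p, u, hd, hl, huA, hlt, fun hpv z hz hpz => ?_⟩
  have hl := hl.resolve_left hpv
  rcases (h.adj_iff p z).1 hpz with ⟨hdz, hlz⟩ | ⟨hdz, hlz⟩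
  · exact Or.inl (h.ext _ _ ((hlz.resolve_left hpv).symm.trans hl) (by omega))
  · by_contra hne
    push Not at hne
    have hlz := hlz.resolve_left hne.2
    have hpA : p ∉ A := fun hp => hA p hp z hz hpz
    have h1 := h.legCount_of_notMem hpA
    have h2 := h.legCount_of_mem hz
    have b1 := h.legCount_bounds B z
    have b2 := h.legCount_bounds B p
    have h3 : legCount d leg B (leg z) (d z) ≤ legCount d leg B (leg u) (d u) + 1 := by
      by_cases hzB : z ∈ B
      · have hpB : p ∉ B := fun hpB => hB p hpB z hzB hpz
        have := h.legCount_of_notMem hpB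
        rw [hl, ← hd] at this
        rw [← hlz, ← hdz, hl] at b1
        rw [← hlz, hl]
        omega
      · have := h.legCount_of_notMem hzB
        rw [← hlz, ← hdz, hl] at this
        rw [hl, ← hd] at b2
        rw [← hlz, hl]
        omega
    rw [hl, ← hd] at h1
    rw [← hlz, ← hdz, hl] at h2
    rw [← hlz, hl] at h3
    have hzT : z ∈ T := by
      simp only [T, Finset.mem_filter, Finset.mem_univ, true_and]
      refine ⟨hne.2, hz, ?_⟩
      rw [← hlz, hl]
      omega
    have := hmin z hzT
    omega

/-- `A` is independent and has at most one token next to the body. -/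
def AtMostOneNearBody (G : SimpleGraph V) (v : V) (A : Finset V) : Prop :=
  IsIndep G A ∧ ∀ a ∈ A, ∀ b ∈ A, G.Adj v a → G.Adj v b → a = b

theorem slide_out_spec (h : SpiderCoords G v d leg) {A B : Finset V}
    (hA : AtMostOneNearBody G v A) {p u : V} (hd : d u = d p + 1)
    (hl : p = v ∨ leg p = leg u) (hp : p ∈ A)
    (hlt : legCount d leg A (leg u) (d u) < legCount d leg B (leg u) (d u))
    (hfree : ∀ z ∈ A, G.Adj u z → z = p) :
    ∃ A', Step G A A' ∧ A'.card = A.card ∧ AtMostOneNearBody G v A' ∧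
      flow d leg v A' B + 1 = flow d leg v A B := by
  have hpu := h.adj_parent hd hl
  have hu : u ∉ A := fun hu => hA.1 p hp u hu hpu
  refine ⟨_, step_slide hpu hp hu, card_slide hp hu, ⟨hA.1.slide hfree, ?_⟩,
    h.flow_slide_out hd hl hp hu hlt⟩
  have key : ∀ b ∈ A, G.Adj v u → ¬ G.Adj v b := by
    intro b hb hvu hvb
    rw [h.adj_body_iff] at hvu
    have hpv : p = v := (h.depth_eq_zero p).1 (by omega)
    exact hA.1 v (hpv ▸ hp) b hb hvb
  intro a ha b hb hva hvb
  rw [Finset.mem_insert, Finset.mem_erase] at ha hb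
  rcases ha with rfl | ⟨-, ha⟩ <;> rcases hb with rfl | ⟨-, hb⟩
  · rfl
  · exact absurd hvb (key b hb hva)
  · exact absurd hva (key a ha hvb)
  · exact hA.2 a ha b hb hva hvb

theorem slide_in_spec (h : SpiderCoords G v d leg) {A B : Finset V}
    (hA : AtMostOneNearBody G v A) {p u : V} (hd : d u = d p + 1)
    (hl : p = v ∨ leg p = leg u) (hu : u ∈ A)
    (hlt : legCount d leg B (leg u) (d u) < legCount d leg A (leg u) (d u))
    (hfree : ∀ z ∈ A, G.Adj p z → z = u) (hnear : ∀ b ∈ A, G.Adj v p → ¬ G.Adj v b) :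
    ∃ A', Step G A A' ∧ A'.card = A.card ∧ AtMostOneNearBody G v A' ∧
      flow d leg v A' B + 1 = flow d leg v A B := by
  have hpu := h.adj_parent hd hl
  have hp : p ∉ A := fun hp => hA.1 p hp u hu hpu
  refine ⟨_, step_slide hpu.symm hu hp, card_slide hu hp, ⟨hA.1.slide hfree, ?_⟩,
    h.flow_slide_in hd hl hp hu hlt⟩
  intro a ha b hb hva hvb
  rw [Finset.mem_insert, Finset.mem_erase] at ha hb
  rcases ha with rfl | ⟨-, ha⟩ <;> rcases hb with rfl | ⟨-, hb⟩
  · rfl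
  · exact absurd hvb (hnear b hb hva)
  · exact absurd hva (hnear a ha hvb)
  · exact hA.2 a ha b hb hva hvb

theorem exists_good_slide_of_body_mem (h : SpiderCoords G v d leg) {A B : Finset V}
    (hA : AtMostOneNearBody G v A) (hB : IsIndep G B) (hvB : v ∈ B) (hcard : A.card = B.card)
    (hne : A ≠ B) (hvA : v ∈ A) :
    ∃ A', Step G A A' ∧ A'.card = A.card ∧ AtMostOneNearBody G v A' ∧
      flow d leg v A' B + 1 = flow d leg v A B := by
  classical
  by_cases hneg : ∃ u, u ≠ v ∧
      legCount d leg A (leg u) (d u) < legCount d leg B (leg u) (d u)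
  · let T : Finset V := Finset.univ.filter fun u => u ≠ v ∧
      legCount d leg A (leg u) (d u) < legCount d leg B (leg u) (d u)
    have hT : T.Nonempty := by
      obtain ⟨u, hu⟩ := hneg
      exact ⟨u, by simpa [T] using hu⟩
    obtain ⟨u, huT, hmin⟩ := T.exists_min_image d hT
    obtain ⟨huv, hlt⟩ := (Finset.mem_filter.1 huT).2
    obtain ⟨p, hd, hl⟩ := h.exists_parent u huv
    have hpA : p ∈ A := by
      by_cases hpv : p = v
      · exact hpv ▸ hvA
      · by_contra hpA
        have hl := hl.resolve_left hpv
        have h1 := h.legCount_of_notMem hpA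
        have h2 := h.legCount_bounds B p
        rw [hl, ← hd] at h1 h2
        have hpT : p ∈ T := by
          simp only [T, Finset.mem_filter, Finset.mem_univ, true_and]
          refine ⟨hpv, ?_⟩
          rw [hl]; omega
        have := hmin p hpT
        omega
    obtain ⟨p', u', hd', hl', hp', hlt', hfree⟩ :=
      h.exists_slide_out hA.1 hB ⟨p, u, hd, hl, hpA, hlt⟩
    exact h.slide_out_spec hA hd' hl' hp' hlt' hfree
  · push Not at hneg
    have hbal : ∀ w, G.Adj v w → legCount d leg B w 1 = legCount d leg A w 1 := by
      have hle : ∀ w ∈ Finset.univ.filter (G.Adj v),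
          legCount d leg B w 1 ≤ legCount d leg A w 1 := by
        intro w hw
        have hw := (Finset.mem_filter.1 hw).2
        have := hneg w hw.ne'
        rwa [h.leg_of_adj w hw, h.adj_body_iff.1 hw] at this
      have hsum := (Finset.sum_eq_sum_iff_of_le hle).1 (by
        rw [h.sum_legCount, h.sum_legCount, Finset.card_erase_of_mem hvA,
          Finset.card_erase_of_mem hvB, hcard])
      exact fun w hw => hsum w (by simpa using hw)
    obtain ⟨x, hxA, hxB⟩ : ∃ x ∈ A, x ∉ B := by
      by_contra hcon
      push Not at hcon
      exact hne (Finset.eq_of_subset_of_card_le hcon hcard.ge)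
    have hxv : x ≠ v := fun h' => hxB (h' ▸ hvB)
    have hxlt : legCount d leg B (leg x) (d x) < legCount d leg A (leg x) (d x) := by
      have h1 := h.legCount_of_mem hxA
      have h2 := h.legCount_of_notMem hxB
      by_contra hcon
      obtain ⟨u, huv, hlu, hdu⟩ := h.exists_of_legCount_pos (A := B) (l := leg x)
        (j := d x + 1) (by omega) (by omega)
      have := hneg u huv
      rw [hlu, hdu] at this
      omega
    obtain ⟨p, u, hd, hl, hu, hlt, hfree⟩ :=
      h.exists_slide_in hA.1 hB ⟨x, hxv, hxA, hxlt⟩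
    have hpv : p ≠ v := by
      rintro rfl
      exact hA.1 p hvA u hu (h.adj_parent hd hl)
    have hvp : ¬ G.Adj v p := by
      intro hvp
      have hpA : p ∉ A := fun hp => hA.1 v hvA p hp hvp
      have hpB : p ∉ B := fun hp => hB v hvB p hp hvp
      have h1 := h.legCount_of_notMem hpA
      have h2 := h.legCount_of_notMem hpB
      have h3 := hbal p hvp
      rw [hl.resolve_left hpv, ← hd] at h1 h2
      rw [← h.adj_body_iff.1 hvp] at h3
      nth_rewrite 1 3 [← h.leg_of_adj p hvp] at h3
      rw [hl.resolve_left hpv] at h3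
      omega
    refine h.slide_in_spec hA hd hl hu hlt (fun z hz hpz => ?_) fun b _ hvp' => absurd hvp' hvp
    rcases hfree hpv z hz hpz with h1 | rfl
    · exact h1
    · exact absurd hpz.symm hvp

theorem exists_good_slide_of_body_notMem (h : SpiderCoords G v d leg) {A B : Finset V}
    (hA : AtMostOneNearBody G v A) (hB : IsIndep G B) (hvB : v ∈ B) (hcard : A.card = B.card)
    (hvA : v ∉ A) :
    ∃ A', Step G A A' ∧ A'.card = A.card ∧ AtMostOneNearBody G v A' ∧
      flow d leg v A' B + 1 = flow d leg v A B := by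
  classical
  by_cases hnear : ∃ w ∈ A, G.Adj v w
  · obtain ⟨w, hwA, hvw⟩ := hnear
    have hwd := h.adj_body_iff.1 hvw
    by_cases hlt : legCount d leg B (leg w) (d w) < legCount d leg A (leg w) (d w)
    · refine h.slide_in_spec hA (p := v) (by rw [h.depth_body, hwd]) (Or.inl rfl) hwA hlt
        (fun z hz hvz => hA.2 z hz w hwA hvz hvw) fun b _ hvv => absurd rfl hvv.ne
    · have hwB : w ∉ B := fun hw => hB v hvB w hw hvw
      have h1 := h.legCount_of_mem hwA
      have h2 := h.legCount_of_notMem hwB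
      obtain ⟨u, huv, hlu, hdu⟩ := h.exists_of_legCount_pos (A := B) (l := leg w)
        (j := d w + 1) (by omega) (by omega)
      obtain ⟨p', u', hd', hl', hp', hlt', hfree⟩ :=
        h.exists_slide_out hA.1 hB ⟨w, u, hdu, Or.inr hlu.symm, hwA, by
          rw [hlu, hdu]; omega⟩
      exact h.slide_out_spec hA hd' hl' hp' hlt' hfree
  · push Not at hnear
    let T : Finset V := Finset.univ.filter fun u => u ≠ v ∧
      legCount d leg B (leg u) (d u) < legCount d leg A (leg u) (d u)
    have hT : T.Nonempty := by
      have hpos : 0 < B.card := Finset.card_pos.2 ⟨v, hvB⟩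
      have hsum : ∑ w ∈ Finset.univ.filter (G.Adj v), legCount d leg B w 1 <
          ∑ w ∈ Finset.univ.filter (G.Adj v), legCount d leg A w 1 := by
        rw [h.sum_legCount, h.sum_legCount, Finset.card_erase_of_mem hvB,
          Finset.erase_eq_of_notMem hvA]
        omega
      obtain ⟨w, hw, hlt⟩ := Finset.exists_lt_of_sum_lt hsum
      have hw := (Finset.mem_filter.1 hw).2
      refine ⟨w, ?_⟩
      simp only [T, Finset.mem_filter, Finset.mem_univ, true_and]
      refine ⟨hw.ne', ?_⟩
      rwa [h.leg_of_adj w hw, h.adj_body_iff.1 hw]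
    obtain ⟨x, hxT, hmax⟩ := T.exists_max_image d hT
    obtain ⟨hxv, hxlt⟩ := (Finset.mem_filter.1 hxT).2
    have hxA : x ∈ A := by
      by_contra hxA
      have h1 := h.legCount_of_notMem hxA
      have h2 := h.legCount_bounds B x
      obtain ⟨u, huv, hlu, hdu⟩ := h.exists_of_legCount_pos (A := A) (l := leg x)
        (j := d x + 1) (by omega) (by omega)
      have huT : u ∈ T := by
        simp only [T, Finset.mem_filter, Finset.mem_univ, true_and]
        refine ⟨huv, ?_⟩
        rw [hlu, hdu]; omega
      have := hmax u huT
      omega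
    obtain ⟨p, u, hd, hl, hu, hlt, hfree⟩ :=
      h.exists_slide_in hA.1 hB ⟨x, hxv, hxA, hxlt⟩
    have hpv : p ≠ v := by
      rintro rfl
      exact hnear u hu (h.adj_parent hd hl)
    refine h.slide_in_spec hA hd hl hu hlt (fun z hz hpz => ?_) fun b hb _ => hnear b hb
    rcases hfree hpv z hz hpz with h1 | rfl
    · exact h1
    · exact absurd hz hvA

/-- Any independent set with at most one token next to the body can be reconfigured, with as few
slides as `flow` allows, to any independent set of the same size that contains the body. -/
theorem exists_isTSSeq_len_eq_flow (h : SpiderCoords G v d leg) {B : Finset V}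
    (hB : IsIndep G B) (hvB : v ∈ B) (n : ℕ) (A : Finset V) (hA : AtMostOneNearBody G v A)
    (hcard : A.card = B.card) (hn : flow d leg v A B = n) :
    ∃ S, IsTSSeq G A B S ∧ S.length = n + 1 := by
  induction n generalizing A with
  | zero =>
    have hAB : A = B := by
      by_contra hne
      by_cases hvA : v ∈ A
      · obtain ⟨A', -, -, -, h'⟩ := h.exists_good_slide_of_body_mem hA hB hvB hcard hne hvA
        omega
      · obtain ⟨A', -, -, -, h'⟩ := h.exists_good_slide_of_body_notMem hA hB hvB hcard hvA
        omega
    subst hAB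
    exact ⟨[A], ⟨by simp, by simp, by simp, by simpa using hB, List.isChain_singleton A⟩, rfl⟩
  | succ n ih =>
    have hex : ∃ A', Step G A A' ∧ A'.card = A.card ∧ AtMostOneNearBody G v A' ∧
        flow d leg v A' B + 1 = flow d leg v A B := by
      by_cases hvA : v ∈ A
      · refine h.exists_good_slide_of_body_mem hA hB hvB hcard ?_ hvA
        rintro rfl
        simp [flow] at hn
      · exact h.exists_good_slide_of_body_notMem hA hB hvB hcard hvA
    obtain ⟨A', hstep, hc, hA', hflow⟩ := hex
    obtain ⟨S, ⟨hS0, hS1, hS2, hS3, hS4⟩, hlen⟩ := ih A' hA' (hc.trans hcard) (by omega)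
    refine ⟨A :: S, ⟨by simp, by simp, ?_, ?_, ?_⟩, by simp [hlen]⟩
    · rw [List.getLast?_cons, hS2]; simp
    · intro C hC
      rcases List.mem_cons.1 hC with rfl | hC
      · exact ⟨hA.1, rfl⟩
      · exact ⟨(hS3 C hC).1, (hS3 C hC).2.trans hc⟩
    · refine List.IsChain.cons hS4 fun C hC => ?_
      rw [hS1, Option.mem_some_iff] at hC
      exact hC ▸ hstep

end SpiderCoords

/-- The indicator of `z` lying on the leg of `u` at least as deep as `u`. -/
def belowInd (d : V → ℕ) (leg : V → V) (u z : V) : ℤ :=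
  if leg z = leg u ∧ d u ≤ d z then 1 else 0

/-- The number of edges of the spider that separate `x` from `y`. -/
def separation (d : V → ℕ) (leg : V → V) (v x y : V) : ℕ :=
  ∑ u ∈ Finset.univ.erase v, (belowInd d leg u x - belowInd d leg u y).natAbs

theorem separation_self (d : V → ℕ) (leg : V → V) (v x : V) : separation d leg v x x = 0 := by
  simp [separation]

theorem separation_comm (d : V → ℕ) (leg : V → V) (v x y : V) :
    separation d leg v x y = separation d leg v y x :=
  Finset.sum_congr rfl fun u _ => by omega

theorem separation_triangle (d : V → ℕ) (leg : V → V) (v x y z : V) :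
    separation d leg v x z ≤ separation d leg v x y + separation d leg v y z := by
  unfold separation
  rw [← Finset.sum_add_distrib]
  exact Finset.sum_le_sum fun u _ => by omega

theorem sum_belowInd (d : V → ℕ) (leg : V → V) (A : Finset V) (u : V) :
    ∑ z ∈ A, belowInd d leg u z = legCount d leg A (leg u) (d u) := by
  rw [legCount, Finset.card_filter]
  push_cast
  rfl

theorem flow_comm (d : V → ℕ) (leg : V → V) (v : V) (A B : Finset V) :
    flow d leg v A B = flow d leg v B A :=
  Finset.sum_congr rfl fun u _ => by omega

namespace SpiderCoords

variable {G : SimpleGraph V} {v : V} {d : V → ℕ} {leg : V → V}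

theorem belowInd_child (h : SpiderCoords G v d leg) {p u : V} (hd : d u = d p + 1)
    (hl : p = v ∨ leg p = leg u) {z : V} (hz : z ≠ v) :
    belowInd d leg z u = belowInd d leg z p + if z = u then 1 else 0 := by
  have hzpos := h.depth_pos hz
  unfold belowInd
  by_cases hzu : z = u
  · subst hzu
    have : ¬ (d z ≤ d p) := by omega
    simp [this]
  · have : (leg u = leg z ∧ d z ≤ d u) ↔ (leg p = leg z ∧ d z ≤ d p) := by
      constructor
      · rintro ⟨h1, h2⟩
        have hne : d z ≠ d u := fun h' => hzu (h.ext _ _ h1.symm h')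
        exact ⟨(hl.resolve_left (h.ne_body (by omega))).trans h1, by omega⟩
      · rintro ⟨h1, h2⟩
        exact ⟨(hl.resolve_left (h.ne_body (by omega))).symm.trans h1, by omega⟩
    simp [this, hzu]

theorem separation_parent (h : SpiderCoords G v d leg) {p u : V} (hd : d u = d p + 1)
    (hl : p = v ∨ leg p = leg u) : separation d leg v u p = 1 := by
  have huv : u ≠ v := h.ne_body (by omega)
  unfold separation
  rw [Finset.sum_congr rfl (g := fun z => if z = u then 1 else 0)]
  · simp [huv]
  · intro z hz
    rw [h.belowInd_child hd hl (Finset.ne_of_mem_erase hz)]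
    split_ifs <;> simp

theorem separation_of_adj (h : SpiderCoords G v d leg) {a b : V} (hab : G.Adj a b) :
    separation d leg v a b = 1 := by
  rcases (h.adj_iff a b).1 hab with ⟨hd, hl⟩ | ⟨hd, hl⟩
  · rw [separation_comm]; exact h.separation_parent hd hl
  · exact h.separation_parent hd (hl.imp id Eq.symm)

theorem separation_le_walk_length (h : SpiderCoords G v d leg) {x y : V} (w : G.Walk x y) :
    separation d leg v x y ≤ w.length := by
  induction w with
  | nil => simp [separation_self]
  | @cons a b c hab q ih =>
    have := separation_triangle d leg v a b c
    rw [h.separation_of_adj hab] at this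
    rw [SimpleGraph.Walk.length_cons]
    omega

theorem exists_parent_separation (h : SpiderCoords G v d leg) {x y : V} (hne : x ≠ y)
    (hle : d y ≤ d x) :
    ∃ p, G.Adj x p ∧ d x = d p + 1 ∧ separation d leg v x y = separation d leg v p y + 1 := by
  have hxv : x ≠ v := by
    rintro rfl
    rw [h.depth_body] at hle
    exact hne ((h.depth_eq_zero y).1 (by omega)).symm
  obtain ⟨p, hd, hl⟩ := h.exists_parent x hxv
  refine ⟨p, (h.adj_parent hd hl).symm, hd, ?_⟩
  unfold separation
  have hmem : x ∈ Finset.univ.erase v := Finset.mem_erase.2 ⟨hxv, Finset.mem_univ x⟩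
  rw [← Finset.add_sum_erase _ _ hmem,
    ← Finset.add_sum_erase (Finset.univ.erase v)
      (fun u => (belowInd d leg u p - belowInd d leg u y).natAbs) hmem]
  have h1 : belowInd d leg x x = 1 := by simp [belowInd]
  have h2 : belowInd d leg x p = 0 := by simp [belowInd, hd]
  have h3 : belowInd d leg x y = 0 := by
    unfold belowInd
    rw [if_neg]
    rintro ⟨h1, h2⟩
    exact hne (h.ext _ _ h1.symm (by omega))
  rw [Finset.sum_congr rfl (g := fun u => (belowInd d leg u p - belowInd d leg u y).natAbs)]
  · rw [h1, h2, h3]; simp; omega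
  · intro z hz
    simp only [Finset.mem_erase] at hz
    rw [h.belowInd_child hd hl hz.2.1, if_neg hz.1, add_zero]

theorem dist_le_separation (h : SpiderCoords G v d leg) (hG : G.Connected) (n : ℕ) (x y : V)
    (hn : d x + d y = n) : G.dist x y ≤ separation d leg v x y := by
  induction n using Nat.strong_induction_on generalizing x y with
  | _ n ih =>
    by_cases hne : x = y
    · subst hne; simp
    · rcases le_total (d y) (d x) with hle | hle
      · obtain ⟨p, hadj, hd, hs⟩ := h.exists_parent_separation hne hle
        have h1 := ih (d p + d y) (by omega) p y rfl
        have h2 : G.dist x y ≤ G.dist x p + G.dist p y := hG.dist_triangle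
        rw [SimpleGraph.dist_eq_one_iff_adj.2 hadj] at h2
        omega
      · obtain ⟨p, hadj, hd, hs⟩ := h.exists_parent_separation (Ne.symm hne) hle
        have h1 := ih (d x + d p) (by omega) x p rfl
        have h2 : G.dist x y ≤ G.dist x p + G.dist p y := hG.dist_triangle
        rw [SimpleGraph.dist_eq_one_iff_adj.2 hadj.symm] at h2
        rw [separation_comm] at hs
        rw [separation_comm d leg v x p] at h1
        omega

theorem dist_eq_separation (h : SpiderCoords G v d leg) (hG : G.Connected) (x y : V) :
    G.dist x y = separation d leg v x y := by
  refine le_antisymm (h.dist_le_separation hG _ x y rfl) ?_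
  obtain ⟨w, hw⟩ := hG.exists_walk_length_eq_dist x y
  rw [← hw]
  exact h.separation_le_walk_length w

theorem separation_of_separated (h : SpiderCoords G v d leg) {p u x y : V} (hd : d u = d p + 1)
    (hl : p = v ∨ leg p = leg u) (hx : belowInd d leg u x = 1) (hy : belowInd d leg u y = 0) :
    separation d leg v x u + 1 + separation d leg v p y ≤ separation d leg v x y := by
  have huv : u ≠ v := h.ne_body (by omega)
  have hmem : u ∈ Finset.univ.erase v := Finset.mem_erase.2 ⟨huv, Finset.mem_univ u⟩
  have hone : (1 : ℕ) = ∑ z ∈ Finset.univ.erase v, if z = u then 1 else 0 := by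
    rw [Finset.sum_ite_eq', if_pos hmem]
  rw [hone]
  unfold separation
  rw [← Finset.sum_add_distrib, ← Finset.sum_add_distrib]
  refine Finset.sum_le_sum fun z hz => ?_
  have hzv := Finset.ne_of_mem_erase hz
  have h1 := h.belowInd_child hd hl hzv
  by_cases hzu : z = u
  · subst hzu
    have h2 : belowInd d leg z z = 1 := by simp [belowInd]
    rw [if_pos rfl] at h1 ⊢
    rw [hx, hy]
    rw [h2] at h1 ⊢
    omega
  · rw [if_neg hzu] at h1 ⊢
    rw [add_zero] at h1
    rw [← h1]
    have hx' : leg x = leg u ∧ d u ≤ d x := by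
      by_contra hc
      simp [belowInd, hc] at hx
    have hy' : ¬(leg y = leg u ∧ d u ≤ d y) := fun hc => by
      simp [belowInd, hc] at hy
    have hfirst : (leg u = leg z ∧ d z ≤ d u) → (leg x = leg z ∧ d z ≤ d x) := fun hc =>
      ⟨hx'.1.trans hc.1, hc.2.trans hx'.2⟩
    have hsecond : (leg x = leg z ∧ d z ≤ d x) → (leg y = leg z ∧ d z ≤ d y) →
        (leg u = leg z ∧ d z ≤ d u) := fun hc hc' => by
      have hu := hx'.1.symm.trans hc.1
      refine ⟨hu, ?_⟩
      by_contra hlt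
      exact hy' ⟨hc'.1.trans hu.symm, by omega⟩
    clear hx hy h1 hx' hy'
    unfold belowInd
    by_cases hu : leg u = leg z ∧ d z ≤ d u
    · rw [if_pos hu, if_pos (hfirst hu)]
      split_ifs <;> decide
    · rw [if_neg hu]
      by_cases hxz : leg x = leg z ∧ d z ≤ d x
      · rw [if_pos hxz, if_neg fun hc => hu (hsecond hxz hc)]
        decide
      · rw [if_neg hxz]
        split_ifs <;> decide

end SpiderCoords

theorem natAbs_sum_of_same_sign {ι : Type*} (s : Finset ι) (f : ι → ℤ)
    (hf : (∀ i ∈ s, 0 ≤ f i) ∨ ∀ i ∈ s, f i ≤ 0) :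
    ∑ i ∈ s, (f i).natAbs = (∑ i ∈ s, f i).natAbs := by
  zify
  rcases hf with hf | hf
  · rw [abs_of_nonneg (Finset.sum_nonneg hf)]
    exact Finset.sum_congr rfl fun i hi => abs_of_nonneg (hf i hi)
  · rw [abs_of_nonpos (Finset.sum_nonpos hf), ← Finset.sum_neg_distrib]
    exact Finset.sum_congr rfl fun i hi => abs_of_nonpos (hf i hi)

theorem SpiderCoords.Mstar_eq_flow {G : SimpleGraph V} {v : V} {d : V → ℕ} {leg : V → V}
    (h : SpiderCoords G v d leg) (hG : G.Connected) {I J : Finset V} (hcard : I.card = J.card) :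
    Mstar G I J = flow d leg v I J := by
  have hmem : Mstar G I J ∈ { m : ℕ | ∃ e : {x // x ∈ I} ≃ {y // y ∈ J},
      m = ∑ x : {x // x ∈ I}, G.dist (x : V) ((e x : V)) } :=
    Nat.sInf_mem ⟨_, Finset.equivOfCardEq hcard, rfl⟩
  obtain ⟨e, he⟩ := hmem
  have hmin : ∀ e' : {x // x ∈ I} ≃ {y // y ∈ J},
      Mstar G I J ≤ ∑ x : {x // x ∈ I}, G.dist (x : V) ((e' x : V)) :=
    fun e' => Nat.sInf_le ⟨e', rfl⟩
  simp only [h.dist_eq_separation hG] at he hmin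
  have hsign : ∀ u ∈ Finset.univ.erase v,
      ∑ x : {x // x ∈ I}, (belowInd d leg u x - belowInd d leg u (e x)).natAbs =
      ((legCount d leg I (leg u) (d u) : ℤ) - legCount d leg J (leg u) (d u)).natAbs := by
    intro u hu
    have huv := Finset.ne_of_mem_erase hu
    have h01 : ∀ z, belowInd d leg u z = 0 ∨ belowInd d leg u z = 1 := fun z => by
      unfold belowInd; split_ifs <;> simp
    rw [natAbs_sum_of_same_sign, Finset.sum_sub_distrib,
      Equiv.sum_comp e (fun y => belowInd d leg u (y : V)),
      Finset.sum_coe_sort I (belowInd d leg u), Finset.sum_coe_sort J (belowInd d leg u),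
      sum_belowInd, sum_belowInd]
    by_contra hcon
    push Not at hcon
    obtain ⟨⟨x', -, hx'⟩, ⟨x, -, hx⟩⟩ := hcon
    have hx1 : belowInd d leg u x = 1 ∧ belowInd d leg u (e x) = 0 := by
      have := h01 x; have := h01 (e x); omega
    have hx'1 : belowInd d leg u x' = 0 ∧ belowInd d leg u (e x') = 1 := by
      have := h01 x'; have := h01 (e x'); omega
    have hne : x' ≠ x := by rintro rfl; omega
    obtain ⟨p, hd, hl⟩ := h.exists_parent u huv
    have s1 := h.separation_of_separated hd hl hx1.1 hx1.2
    have s2 := h.separation_of_separated hd hl hx'1.2 hx'1.1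
    have t1 := separation_triangle d leg v x u (e x')
    have t2 := separation_triangle d leg v x' p (e x)
    rw [separation_comm d leg v u] at t1
    rw [separation_comm d leg v x' p] at t2
    rw [separation_comm d leg v (e x') x'] at s2
    have hm := hmin ((Equiv.swap x x').trans e)
    have hx'mem : x' ∈ Finset.univ.erase x := Finset.mem_erase.2 ⟨hne, Finset.mem_univ _⟩
    have hsplit : ∀ f : {x // x ∈ I} → ℕ,
        ∑ z, f z = f x + (f x' + ∑ z ∈ (Finset.univ.erase x).erase x', f z) := fun f => by
      rw [Finset.add_sum_erase _ _ hx'mem, Finset.add_sum_erase _ _ (Finset.mem_univ x)]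
    rw [he, hsplit (fun z => separation d leg v z (e z)),
      hsplit (fun z => separation d leg v z (((Equiv.swap x x').trans e) z))] at hm
    have hrest : ∑ z ∈ (Finset.univ.erase x).erase x',
        separation d leg v z (((Equiv.swap x x').trans e) z) =
        ∑ z ∈ (Finset.univ.erase x).erase x', separation d leg v z (e z) := by
      refine Finset.sum_congr rfl fun z hz => ?_
      simp only [Finset.mem_erase] at hz
      rw [Equiv.trans_apply, Equiv.swap_apply_of_ne_of_ne hz.2.1 hz.1]
    rw [hrest] at hm
    simp only [Equiv.trans_apply, Equiv.swap_apply_left, Equiv.swap_apply_right] at hm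
    omega
  rw [he]
  unfold separation flow
  rw [Finset.sum_comm]
  exact Finset.sum_congr rfl hsign

theorem moveCount_cons_cons (A B : Finset V) (S : List (Finset V)) (x y : V) :
    moveCount (A :: B :: S) x y =
      (if A \ B = {x} ∧ B \ A = {y} then 1 else 0) + moveCount (B :: S) x y := by
  unfold moveCount
  simp only [List.tail_cons, List.zip_cons_cons, List.filter_cons]
  split_ifs <;> simp_all [add_comm]

theorem exists_pair_of_moveCount_pos {S : List (Finset V)} {x y : V}
    (h : 0 < moveCount S x y) : ∃ A ∈ S, ∃ B ∈ S, A \ B = {x} ∧ B \ A = {y} := by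
  obtain ⟨⟨A, B⟩, hp⟩ := List.exists_mem_of_length_pos h
  obtain ⟨h1, h2⟩ := List.mem_filter.1 hp
  obtain ⟨hA, hB⟩ := List.of_mem_zip h1
  exact ⟨A, hA, B, List.mem_of_mem_tail hB, by simpa using h2⟩

theorem eq_slide_of_sdiff {A B : Finset V} {x y : V} (h1 : A \ B = {x}) (h2 : B \ A = {y}) :
    x ∈ A ∧ y ∉ A ∧ y ∈ B ∧ x ∉ B ∧ B = insert y (A.erase x) ∧ A = insert x (B.erase y) := by
  have hA : ∀ z, (z ∈ A ∧ z ∉ B) ↔ z = x := fun z => by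
    rw [← Finset.mem_sdiff, h1, Finset.mem_singleton]
  have hB : ∀ z, (z ∈ B ∧ z ∉ A) ↔ z = y := fun z => by
    rw [← Finset.mem_sdiff, h2, Finset.mem_singleton]
  have hx := (hA x).2 rfl
  have hy := (hB y).2 rfl
  refine ⟨hx.1, hy.2, hy.1, hx.2, ?_, ?_⟩
  · ext z
    have hAz := hA z
    have hBz := hB z
    rw [Finset.mem_insert, Finset.mem_erase]
    tauto
  · ext z
    have hAz := hA z
    have hBz := hB z
    rw [Finset.mem_insert, Finset.mem_erase]
    tauto

/-- A token that never moves along any edge stays in place. -/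
theorem mem_of_moveCount_eq_zero {G : SimpleGraph V} {w : V} (S : List (Finset V))
    (A : Finset V) (hw : w ∈ A) (hS : List.IsChain (Step G) (A :: S))
    (hmove : ∀ z, G.Adj w z → moveCount (A :: S) w z = 0) : ∀ B ∈ A :: S, w ∈ B := by
  induction S generalizing A with
  | nil => simpa using hw
  | cons C S ih =>
    obtain ⟨⟨x, y, hxy, h1, h2⟩, hchain⟩ := List.isChain_cons_cons.1 hS
    have hwC : w ∈ C := by
      by_contra hwC
      have hwx : w = x := by
        rw [← Finset.mem_singleton, ← h1, Finset.mem_sdiff]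
        exact ⟨hw, hwC⟩
      subst hwx
      have := hmove y hxy
      rw [moveCount_cons_cons, if_pos ⟨h1, h2⟩] at this
      omega
    have hrec := ih C hwC hchain fun z hz => by
      have := hmove z hz
      rw [moveCount_cons_cons] at this
      omega
    intro B hB
    rcases List.mem_cons.1 hB with rfl | hB
    · exact hw
    · exact hrec B hB

namespace SpiderCoords

variable {G : SimpleGraph V} {v : V} {d : V → ℕ} {leg : V → V}

theorem parent_unique (h : SpiderCoords G v d leg) {p q u : V} (hd : d u = d p + 1)
    (hl : p = v ∨ leg p = leg u) (hd' : d u = d q + 1) (hl' : q = v ∨ leg q = leg u) :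
    p = q := by
  by_cases hpv : p = v
  · subst hpv
    have := h.depth_body
    exact ((h.depth_eq_zero q).1 (by omega)).symm
  · have := h.depth_pos hpv
    exact h.ext _ _ ((hl.resolve_left hpv).trans
      (hl'.resolve_left (h.ne_body (by omega))).symm) (by omega)

theorem legCount_step (h : SpiderCoords G v d leg) {A B : Finset V} (hAB : Step G A B)
    {p u : V} (hd : d u = d p + 1) (hl : p = v ∨ leg p = leg u) :
    legCount d leg B (leg u) (d u) + (if A \ B = {u} ∧ B \ A = {p} then 1 else 0) =
      legCount d leg A (leg u) (d u) + (if A \ B = {p} ∧ B \ A = {u} then 1 else 0) := by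
  have huv : u ≠ v := h.ne_body (by omega)
  obtain ⟨x, y, hxy, h1, h2⟩ := hAB
  obtain ⟨hxA, hyA, hyB, hxB, hB, hA⟩ := eq_slide_of_sdiff h1 h2
  simp only [h1, h2, Finset.singleton_inj]
  rcases (h.adj_iff x y).1 hxy with ⟨hd', hl'⟩ | ⟨hd', hl'⟩
  · have hs := h.legCount_slide hd' hl' hxA hyA huv
    rw [← hB] at hs
    rw [hs, if_neg (c := x = u ∧ y = p) (by rintro ⟨rfl, rfl⟩; omega)]
    by_cases hu : u = y
    · subst hu
      rw [if_pos rfl, if_pos ⟨h.parent_unique hd' hl' hd hl, rfl⟩]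
    · rw [if_neg hu, if_neg fun h' => hu h'.2.symm]
  · have hl' := hl'.imp id (fun h : leg x = leg y => h.symm)
    have hs := h.legCount_slide hd' hl' hyB hxB huv
    rw [← hA] at hs
    rw [hs, if_neg (c := x = p ∧ y = u) (by rintro ⟨rfl, rfl⟩; omega)]
    by_cases hu : u = x
    · subst hu
      rw [if_pos rfl, if_pos ⟨rfl, h.parent_unique hd' hl' hd hl⟩]
    · rw [if_neg hu, if_neg fun h' => hu h'.1.symm]

/-- The net number of moves from `p` to its child `u` is the change of the count below `u`. -/
theorem legCount_add_moveCount (h : SpiderCoords G v d leg) {p u : V} (hd : d u = d p + 1)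
    (hl : p = v ∨ leg p = leg u) (S : List (Finset V)) (A J : Finset V)
    (hS : List.IsChain (Step G) (A :: S)) (hJ : (A :: S).getLast? = some J) :
    legCount d leg J (leg u) (d u) + moveCount (A :: S) u p =
      legCount d leg A (leg u) (d u) + moveCount (A :: S) p u := by
  induction S generalizing A with
  | nil =>
    simp only [List.getLast?_singleton, Option.some.injEq] at hJ
    subst hJ
    simp [moveCount]
  | cons C S ih =>
    obtain ⟨hstep, hchain⟩ := List.isChain_cons_cons.1 hS
    have h1 := ih C hchain (by rwa [List.getLast?_cons_cons] at hJ)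
    have h2 := h.legCount_step hstep hd hl
    rw [moveCount_cons_cons, moveCount_cons_cons]
    omega

theorem ILegCard_eq (h : SpiderCoords G v d leg) {A : Finset V} (hv : v ∉ A) {w : V} (w₁ : V)
    (hw : G.Adj v w) : ILegCard G A v w₁ w = legCount d leg A (leg w) (d w) := by
  have hset : ILeg G A v w₁ w =
      ((A.filter fun z => leg z = leg w ∧ d w ≤ d z : Finset V) : Set V) := by
    have hempty : (A : Set V) ∩ {v} = ∅ := by simpa using hv
    unfold ILeg
    rw [hempty, ite_self, Set.union_empty]
    ext z
    rw [h.leg_of_adj w hw, h.adj_body_iff.1 hw, Set.mem_inter_iff, h.mem_side w z hw]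
    simp only [Finset.mem_coe, Finset.coe_filter, Set.mem_ofPred_eq]
    refine and_congr_right fun hz => ⟨fun h' => ⟨h', h.depth_pos ?_⟩, fun h' => h'.1⟩
    rintro rfl
    exact hv hz
  unfold ILegCard legCount
  rw [hset, Set.ncard_coe_finset]

/-- A token next to the body which blocks a transfer between legs has to make a detour. -/
theorem exists_makesDetour (h : SpiderCoords G v d leg) {I J : Finset V} {w w' : V}
    (hvw : G.Adj v w) (hwI : w ∈ I) (hwJ : w ∈ J)
    (hw : legCount d leg I (leg w) (d w) = legCount d leg J (leg w) (d w))
    (hvw' : G.Adj v w')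
    (hw' : legCount d leg I (leg w') (d w') ≠ legCount d leg J (leg w') (d w'))
    {S : List (Finset V)} (hS : IsTSSeq G I J S) :
    ∃ a b, G.Adj a b ∧ MakesDetour S a b := by
  obtain ⟨hS0, hS1, hS2, hS3, hS4⟩ := hS
  obtain ⟨A, S, rfl⟩ := List.exists_cons_of_ne_nil hS0
  simp only [List.head?_cons, Option.some.injEq] at hS1
  subst hS1
  have hbody : d v = 0 := h.depth_body
  have hcount := fun u (hu : G.Adj v u) =>
    h.legCount_add_moveCount (p := v) (u := u) (by rw [hbody, h.adj_body_iff.1 hu]) (Or.inl rfl)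
      S A J hS4 hS2
  have hvmem : ∃ C ∈ A :: S, v ∈ C := by
    have hc := hcount w' hvw'
    have : 0 < moveCount (A :: S) v w' ∨ 0 < moveCount (A :: S) w' v := by omega
    rcases this with h0 | h0
    · obtain ⟨C, hC, D, -, h1, h2⟩ := exists_pair_of_moveCount_pos h0
      exact ⟨C, hC, (eq_slide_of_sdiff h1 h2).1⟩
    · obtain ⟨C, -, D, hD, h1, h2⟩ := exists_pair_of_moveCount_pos h0
      exact ⟨D, hD, (eq_slide_of_sdiff h1 h2).2.2.1⟩
  obtain ⟨C, hC, hvC⟩ := hvmem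
  obtain ⟨z, hwz, hz⟩ : ∃ z, G.Adj w z ∧ moveCount (A :: S) w z ≠ 0 := by
    by_contra hcon
    push Not at hcon
    exact (hS3 C hC).1 v hvC w (mem_of_moveCount_eq_zero S A hwI hS4 hcon C hC) hvw
  refine ⟨w, z, hwz, Nat.pos_of_ne_zero hz, ?_⟩
  have hwd := h.adj_body_iff.1 hvw
  rcases (h.adj_iff w z).1 hwz with ⟨hd, hl⟩ | ⟨hd, hl⟩
  · have hc := h.legCount_add_moveCount hd hl S A J hS4 hS2
    have h1 := h.legCount_of_mem hwI
    have h2 := h.legCount_of_mem hwJ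
    have hl := hl.resolve_left hvw.ne'
    rw [← hl, hd] at hc
    omega
  · have hzv : z = v := (h.depth_eq_zero z).1 (by omega)
    subst hzv
    have hc := hcount w hvw
    omega

end SpiderCoords

theorem two_le_totalDetours {G : SimpleGraph V} {S : List (Finset V)} {a b : V}
    (hab : G.Adj a b) (h : MakesDetour S a b) : 2 ≤ totalDetours G S := by
  classical
  unfold totalDetours
  refine le_trans ?_ (Finset.single_le_sum (f := detours S) (a := s(a, b))
    (fun _ _ => Nat.zero_le _) (by simpa using hab))
  obtain ⟨h1, h2⟩ := h
  change 2 ≤ 2 * min (moveCount S a b) (moveCount S b a)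
  omega

/-- Lemma 6(i) of the paper. Suppose `|I ∩ N(v)| ≤ 1`,
`|J ∩ N(v)| ≤ 1`, some leg `L'` has `|I_{L'}| ≠ |J_{L'}|`, `I ∩ N(v) = {x}`,
`J ∩ N(v) = {y}`, and `x, y` lie in the same leg `L` with `|I_L| = |J_L|`.
Then every TS-sequence `S` between `I` and `J` has `D_G(S) ≥ 2` (hence
`D*(G,I,J) ≥ 2`), and a TS-sequence of length `M*(G,I,J) + 2` exists. -/
theorem spider_one_token_near_body_forced_detour
    {V : Type*} [Fintype V] [DecidableEq V] (G : SimpleGraph V) (v : V)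
    (hG : IsSpider G v) (I J : Finset V)
    (hI : IsIndep G I) (hJ : IsIndep G J) (hcard : I.card = J.card)
    (hreconf : Reconf G I J)
    (hIrigid : ∀ u ∈ I, ¬ RigidToken G I u)
    (hJrigid : ∀ u ∈ J, ¬ RigidToken G J u)
    (hIN : ((I : Set V) ∩ G.neighborSet v).ncard ≤ 1)
    (hJN : ((J : Set V) ∩ G.neighborSet v).ncard ≤ 1)
    (w₁ : V) (hw₁ : IsFirstLeg G I J v w₁)
    (hleg : ∃ w', G.Adj v w' ∧ ILegCard G I v w₁ w' ≠ ILegCard G J v w₁ w')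
    (x y : V)
    (hx : (I : Set V) ∩ G.neighborSet v = {x})
    (hy : (J : Set V) ∩ G.neighborSet v = {y})
    (hsame : ∃ w, G.Adj v w ∧ x ∈ side G v w ∧ y ∈ side G v w ∧
      ILegCard G I v w₁ w = ILegCard G J v w₁ w) :
    (∀ S, IsTSSeq G I J S → 2 ≤ totalDetours G S) ∧
    2 ≤ Dstar G I J ∧
    (∃ S, IsTSSeq G I J S ∧ len S = Mstar G I J + 2) := by
  obtain ⟨d, leg, h⟩ := hG.exists_coords
  have hxI : x ∈ I ∧ G.Adj v x := by
    have : x ∈ (I : Set V) ∩ G.neighborSet v := hx ▸ rfl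
    simpa using this
  have hyJ : y ∈ J ∧ G.Adj v y := by
    have : y ∈ (J : Set V) ∩ G.neighborSet v := hy ▸ rfl
    simpa using this
  have hvI : v ∉ I := fun hv => hI v hv x hxI.1 hxI.2
  have hvJ : v ∉ J := fun hv => hJ v hv y hyJ.1 hyJ.2
  obtain ⟨w, hvw, hxw, hyw, hbal⟩ := hsame
  rw [h.mem_side w _ hvw, h.leg_of_adj _ hxI.2] at hxw
  rw [h.mem_side w _ hvw, h.leg_of_adj _ hyJ.2] at hyw
  subst hxw
  subst hyw
  rw [h.ILegCard_eq hvI w₁ hvw, h.ILegCard_eq hvJ w₁ hvw] at hbal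
  obtain ⟨w', hvw', hne⟩ := hleg
  rw [h.ILegCard_eq hvI w₁ hvw', h.ILegCard_eq hvJ w₁ hvw'] at hne
  have hdetour : ∀ S, IsTSSeq G I J S → 2 ≤ totalDetours G S := by
    intro S hS
    obtain ⟨a, b, hab, hdet⟩ := h.exists_makesDetour hvw hxI.1 hyJ.1 hbal hvw' hne hS
    exact two_le_totalDetours hab hdet
  refine ⟨hdetour, ?_, ?_⟩
  · obtain ⟨S, hS⟩ := hreconf
    refine le_csInf ⟨_, S, hS, rfl⟩ ?_
    rintro _ ⟨S, hS, rfl⟩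
    exact hdetour S hS
  · have hnearI : ∀ a ∈ I, ∀ b ∈ I, G.Adj v a → G.Adj v b → a = b := by
      have key : ∀ a ∈ I, G.Adj v a → a = y := fun a ha hva => by
        have : a ∈ (I : Set V) ∩ G.neighborSet v := ⟨ha, hva⟩
        rwa [hx] at this
      exact fun a ha b hb hva hvb => (key a ha hva).trans (key b hb hvb).symm
    have hfree : ∀ z ∈ J, G.Adj v z → z = y := fun z hz hvz => by
      have : z ∈ (J : Set V) ∩ G.neighborSet v := ⟨hz, hvz⟩
      rwa [hy] at this
    set B := insert v (J.erase y) with hB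
    have hBcard : B.card = J.card := card_slide hyJ.1 hvJ
    have hBI : IsIndep G B := hJ.slide hfree
    have hvB : v ∈ B := Finset.mem_insert_self _ _
    have hyB : y ∉ B := by simp [hB, hvw.ne']
    have hback : insert y (B.erase v) = J := by
      rw [hB, Finset.erase_insert (fun h' => hvJ (Finset.mem_of_mem_erase h')),
        Finset.insert_erase hyJ.1]
    have hdepth : d y = d v + 1 := by rw [h.depth_body, h.adj_body_iff.1 hvw]
    have hstep : Step G B J := hback ▸ step_slide hvw hvB hyB
    have hcount := h.legCount_slide hdepth (Or.inl rfl) hvB hyB hvw.ne'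
    rw [hback, if_pos rfl] at hcount
    have hflow := h.flow_slide_out (B := I) hdepth (Or.inl rfl) hvB hyB (by omega)
    rw [hback, flow_comm, flow_comm d leg v B I] at hflow
    obtain ⟨S, ⟨hS0, hS1, hS2, hS3, hS4⟩, hlen⟩ :=
      h.exists_isTSSeq_len_eq_flow hBI hvB _ I ⟨hI, hnearI⟩
        (hcard.trans hBcard.symm) rfl
    refine ⟨S ++ [J], ⟨by simp, ?_, by simp, ?_, ?_⟩, ?_⟩
    · rw [List.head?_append, hS1]; rfl
    · intro C hC
      rcases List.mem_append.1 hC with hC | hC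
      · exact hS3 C hC
      · rw [List.mem_singleton.1 hC]
        exact ⟨hJ, hcard.symm⟩
    · refine List.IsChain.append hS4 (List.isChain_singleton J) fun C hC D hD => ?_
      rw [hS2, Option.mem_some_iff] at hC
      rw [List.head?_cons, Option.mem_some_iff] at hD
      subst hC hD
      exact hstep
    · rw [h.Mstar_eq_flow hG.1.connected hcard]
      unfold len
      rw [List.length_append, hlen, List.length_singleton]
      omega


end SlidingTokenPaper
end

section
/- Let T be a tree, let xy be an edge of T, and let I and J be independent sets of T with |I| = |J| and |I ∩ V(T^x_y)| > |J ∩ V(T^x_y)|. Then every TS-sequence between I and J contains the move y → x; that is, in every TS-sequence ⟨I_1, …, I_ℓ⟩ between I and J there is an index i with I_i \ I_{i+1} = {y} and I_{i+1} \ I_i = {x}. -/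
/-!
Common definitions for formalizing "Shortest Reconfiguration Sequence for
Sliding Tokens on Spiders" (Hoang, Khorramian, Uehara).
-/

namespace SlidingTokenPaper

variable {V : Type*} [Fintype V] [DecidableEq V]

/-- A shortest walk from `z` to `y` avoids `x` if `x` is at least as far from `z` as `y`. -/
lemma notMem_support_of_dist_le {V : Type*} {G : SimpleGraph V} {x y z : V} (hne : x ≠ y)
    (h : G.dist z y ≤ G.dist z x) (p : G.Walk z y) (hp : p.length = G.dist z y) :
    x ∉ p.support := by
  classical
  intro hx
  have h₁ := p.length_takeUntil_lt_length hx hne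
  have h₂ := SimpleGraph.dist_le (p.takeUntil x hx)
  omega

/-- If `x` is at least as far from `z` as `y`, then `z` and `y` stay connected after deleting
the edge `xy`. -/
lemma reachable_deleteEdges_of_dist_le {V : Type*} {G : SimpleGraph V} (hG : G.Connected)
    {x y z : V} (hne : x ≠ y) (h : G.dist z y ≤ G.dist z x) :
    (G.deleteEdges {s(x, y)}).Reachable z y := by
  obtain ⟨p, hp⟩ := hG.exists_walk_length_eq_dist z y
  have hx := notMem_support_of_dist_le hne h p hp
  exact ⟨p.toDeleteEdge s(x, y) fun he => hx (p.fst_mem_support_of_mem_edges he)⟩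

/-- In a tree, the only edge leaving `side T x y` is `xy`. -/
lemma eq_of_adj_of_mem_side_of_notMem_side {V : Type*} {T : SimpleGraph V} (hT : T.IsTree)
    {x y u v : V} (hxy : T.Adj x y) (huv : T.Adj u v) (hu : u ∈ side T x y)
    (hv : v ∉ side T x y) : u = y ∧ v = x := by
  have hu' : T.dist u y < T.dist u x := hu
  have hv' : T.dist v x ≤ T.dist v y := not_lt.mp hv
  by_contra hne
  have huy := reachable_deleteEdges_of_dist_le hT.connected hxy.ne hu'.le
  have hvx := reachable_deleteEdges_of_dist_le hT.connected hxy.ne.symm hv'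
  rw [Sym2.eq_swap] at hvx
  have hadj : (T.deleteEdges {s(x, y)}).Adj u v := by
    rw [SimpleGraph.deleteEdges_adj]
    refine ⟨huv, fun he => ?_⟩
    rcases Sym2.eq_iff.mp (Set.mem_singleton_iff.mp he) with ⟨rfl, rfl⟩ | h
    · simp at hu'
    · exact hne h
  have hb := SimpleGraph.isAcyclic_iff_forall_adj_isBridge.mp hT.isAcyclic hxy
  rw [SimpleGraph.isBridge_iff] at hb
  exact hb ((huy.symm.trans (hadj.reachable.trans hvx)).symm)

/-- If exchanging `a` for `b` decreases the intersection with `s`, then `a` lies in `s` and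
`b` does not. -/
lemma mem_and_notMem_of_ncard_inter_lt {V : Type*} [DecidableEq V] {A B : Finset V} {a b : V}
    (s : Set V) (hAB : A \ B = {a}) (hBA : B \ A = {b})
    (h : ((B : Set V) ∩ s).ncard < ((A : Set V) ∩ s).ncard) : a ∈ s ∧ b ∉ s := by
  have hA : ∀ z ∈ A, z ≠ a → z ∈ B := fun z hz hne => by
    by_contra hB
    exact hne (Finset.mem_singleton.mp (hAB ▸ Finset.mem_sdiff.mpr ⟨hz, hB⟩))
  have hb : b ∈ B ∧ b ∉ A := Finset.mem_sdiff.mp (hBA ▸ Finset.mem_singleton_self b)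
  have hfin : ((B : Set V) ∩ s).Finite := B.finite_toSet.inter_of_left s
  have ha : a ∈ s := by
    by_contra ha
    exact not_le.mpr h (Set.ncard_le_ncard
      (fun z hz => ⟨hA z hz.1 fun e => ha (e ▸ hz.2), hz.2⟩ : (A : Set V) ∩ s ⊆ B ∩ s) hfin)
  refine ⟨ha, fun hbs => not_le.mpr h ?_⟩
  refine Set.ncard_le_ncard_of_injOn (fun z => if z = a then b else z) ?_ ?_ hfin
  · intro z hz
    split_ifs with hza
    · exact ⟨hb.1, hbs⟩
    · exact ⟨hA z hz.1 hza, hz.2⟩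
  · intro z hz w hw hzw
    have hzA : z ∈ A := hz.1
    have hwA : w ∈ A := hw.1
    dsimp only at hzw
    split_ifs at hzw <;> grind

/-- A chain whose last element has a smaller `f`-value than its first one contains a step along
which `f` decreases. -/
lemma exists_mem_zip_tail_lt {α : Type*} {R : α → α → Prop} (f : α → ℕ) {S : List α} {a b : α}
    (hS : S.IsChain R) (ha : S.head? = some a) (hb : S.getLast? = some b) (h : f b < f a) :
    ∃ p ∈ S.zip S.tail, R p.1 p.2 ∧ f p.2 < f p.1 := by
  induction S generalizing a with
  | nil => simp at ha
  | cons c S ih =>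
    obtain rfl : c = a := by simpa using ha
    cases S with
    | nil =>
      obtain rfl : c = b := by simpa using hb
      exact absurd h (lt_irrefl _)
    | cons d S =>
      rw [List.isChain_cons_cons] at hS
      by_cases hd : f d < f c
      · exact ⟨(c, d), by simp, hS.1, hd⟩
      · obtain ⟨p, hp, hp'⟩ := ih hS.2 rfl (by simpa using hb) (by omega)
        exact ⟨p, by simpa using Or.inr hp, hp'⟩

/-- If `xy` is an edge of a tree `T` and
`|I ∩ V(T^x_y)| > |J ∩ V(T^x_y)|`, then every TS-sequence between `I` and `J`
contains the move `y → x`. -/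
theorem tree_unbalanced_side_forces_move
    {V : Type*} [Fintype V] [DecidableEq V] (T : SimpleGraph V) (hT : T.IsTree)
    (x y : V) (hxy : T.Adj x y) (I J : Finset V)
    (hI : IsIndep T I) (hJ : IsIndep T J) (hcard : I.card = J.card)
    (hcount : ((J : Set V) ∩ side T x y).ncard < ((I : Set V) ∩ side T x y).ncard)
    (S : List (Finset V)) (hS : IsTSSeq T I J S) :
    ∃ p ∈ S.zip S.tail, p.1 \ p.2 = {y} ∧ p.2 \ p.1 = {x} := by
  obtain ⟨-, hhead, hlast, -, hchain⟩ := hS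
  obtain ⟨p, hp, ⟨a, b, hab, hpa, hpb⟩, hlt⟩ := exists_mem_zip_tail_lt
    (fun A : Finset V => ((A : Set V) ∩ side T x y).ncard) hchain hhead hlast hcount
  obtain ⟨ha, hb⟩ := mem_and_notMem_of_ncard_inter_lt _ hpa hpb hlt
  obtain ⟨rfl, rfl⟩ := eq_of_adj_of_mem_side_of_notMem_side hT hxy hab ha hb
  exact ⟨p, hp, hpa, hpb⟩

end SlidingTokenPaper
end

section
/- Let G be a spider with body v, and let I and J be independent sets of G with |I| = |J| such that I ↭ J, no token of I is (G,I)-rigid, and no token of J is (G,J)-rigid. Suppose that I ∩ N(v) = ∅ and J ∩ N(v) = ∅, and that some leg L of G satisfies |I_L| ≠ |J_L|. Then there exist a bijection f : I → J with ∑_{w∈I} dist_G(w, f(w)) = M*(G,I,J) and an enumeration w_1, …, w_k of I (k = |I|) such that the following holds: for each i from 1 to k, after the tokens on w_1, …, w_{i−1} have been slid to f(w_1), …, f(w_{i−1}) respectively, the token on w_i can be slid to f(w_i) along the unique w_i–f(w_i) path in G with every intermediate vertex set an independent set; the concatenation of these direct slides is a TS-sequence between I and J of length M*(G,I,J). -/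
/-!
Common definitions for formalizing "Shortest Reconfiguration Sequence for
Sliding Tokens on Spiders" (Hoang, Khorramian, Uehara).
-/

namespace SlidingTokenPaper

variable {V : Type*} [Fintype V] [DecidableEq V]

/-- The token configuration reached after the tokens on `w 0, …, w (i-1)` have
been slid to their targets `f (w 0), …, f (w (i-1))`, while the remaining tokens
`w i, …, w (k-1)` are still at their initial positions. -/
def config {V : Type*} [Fintype V] [DecidableEq V] {k : ℕ}
    (f : V → V) (w : Fin k → V) (i : ℕ) : Finset V :=
  ((Finset.univ.filter fun t : Fin k => i ≤ (t : ℕ)).image w) ∪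
  ((Finset.univ.filter fun t : Fin k => (t : ℕ) < i).image fun t => f (w t))


section Coordinates

variable {V : Type*} {G : SimpleGraph V}

lemma exists_adj_dist_eq (hG : G.Connected) {a b : V} {n : ℕ} (h : G.dist a b = n + 1) :
    ∃ c, G.Adj a c ∧ G.dist c b = n := by
  obtain ⟨p, hp⟩ := hG.exists_walk_length_eq_dist a b
  cases p with
  | nil => simp at h
  | cons hac q =>
    rename_i c
    refine ⟨c, hac, ?_⟩
    have h1 := G.dist_le q
    have h2 : G.dist a b ≤ G.dist a c + G.dist c b := hG.dist_triangle
    rw [SimpleGraph.dist_eq_one_iff_adj.2 hac] at h2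
    simp at hp
    omega

lemma parent_unique (hG : G.IsTree) {v x a b : V} (ha : G.Adj x a) (hb : G.Adj x b)
    (hra : G.dist v x = G.dist v a + 1) (hrb : G.dist v x = G.dist v b + 1) : a = b := by
  obtain ⟨p, hp⟩ := hG.connected.exists_walk_length_eq_dist v a
  obtain ⟨q, hq⟩ := hG.connected.exists_walk_length_eq_dist v b
  have hp' : (p.concat ha.symm).IsPath :=
    SimpleGraph.Walk.isPath_of_length_eq_dist _ (by simp [hp, hra])
  have hq' : (q.concat hb.symm).IsPath :=
    SimpleGraph.Walk.isPath_of_length_eq_dist _ (by simp [hq, hrb])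
  have h := (hG.isAcyclic.subsingleton_path v x).elim ⟨_, hp'⟩ ⟨_, hq'⟩
  have h2 := congrArg (fun w => w.1.penultimate) h
  simpa using h2

/-- Spider coordinates: every vertex is determined by its leg and its distance to the body. -/
lemma exists_coordinates [Finite V] [DecidableEq V] (hG : G.IsTree) (v : V)
    (hdeg : ∀ w, 3 ≤ (G.neighborSet w).ncard → w = v) :
    ∃ leg : V → V, ∀ x y, G.dist x y =
      if leg x = leg y then (G.dist v x - G.dist v y) + (G.dist v y - G.dist v x)
      else G.dist v x + G.dist v y := by
  have hc := hG.connected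
  have hpar : ∀ x, ∃ c, x ≠ v → G.Adj x c ∧ G.dist v x = G.dist v c + 1 := by
    intro x
    by_cases hx : x = v
    · exact ⟨x, fun h => absurd hx h⟩
    · have h0 := hc.pos_dist_of_ne hx
      obtain ⟨c, hxc, hcd⟩ := exists_adj_dist_eq hc (a := x) (b := v) (n := G.dist x v - 1)
        (by omega)
      refine ⟨c, fun _ => ⟨hxc, ?_⟩⟩
      rw [G.dist_comm (u := v), G.dist_comm (u := v)]
      omega
  choose p hp using hpar
  set r : V → ℕ := fun x => G.dist v x with hr
  have hr0 : ∀ x, r x = 0 ↔ x = v := fun x => by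
    rw [hr]; simp only [hc.dist_eq_zero_iff]; exact eq_comm
  let leg : V → V := fun x => p^[r x - 1] x
  have leg_one : ∀ x, r x = 1 → leg x = x := fun x hx => by simp [leg, hx]
  have leg_par : ∀ x, 2 ≤ r x → leg (p x) = leg x := fun x hx => by
    have hxv : x ≠ v := fun h => by have := (hr0 x).2 h; omega
    have h1 : r x = r (p x) + 1 := (hp x hxv).2
    obtain ⟨m, hm⟩ : ∃ m, r (p x) = m + 1 := ⟨r (p x) - 1, by omega⟩
    simp [leg, h1, hm]
  have leg_adj : ∀ x y, G.Adj x y → x ≠ v → y ≠ v → leg x = leg y := by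
    have key : ∀ x y, G.Adj x y → x ≠ v → y ≠ v → r y = r x + 1 → leg x = leg y := by
      intro x y hxy hx hy h
      have : p y = x := parent_unique hG (hp y hy).1 hxy.symm (hp y hy).2 h
      have hx0 : r x ≠ 0 := fun h => hx ((hr0 x).1 h)
      rw [← leg_par y (by omega), this]
    intro x y hxy hx hy
    rcases hG.dist_eq_dist_add_one_of_adj v hxy with h | h
    · exact (key y x hxy.symm hy hx h).symm
    · exact key x y hxy hx hy h
  have same : ∀ n x y, r x = n + 1 → r y = n + 1 → leg x = leg y → x = y := by
    intro n
    induction n with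
    | zero => intro x y hx hy h; rwa [leg_one x hx, leg_one y hy] at h
    | succ n ih =>
      intro x y hx hy h
      have hxv : x ≠ v := fun h => by have := (hr0 x).2 h; omega
      have hyv : y ≠ v := fun h => by have := (hr0 y).2 h; omega
      have hpx : r x = r (p x) + 1 := (hp x hxv).2
      have hpy : r y = r (p y) + 1 := (hp y hyv).2
      have hpp : p x = p y := ih _ _ (by omega) (by omega)
        (by rw [leg_par x (by omega), leg_par y (by omega), h])
      by_contra hxy
      have hpv : p x ≠ v := fun h => by have := (hr0 _).2 h; omega
      refine hpv (hdeg _ ?_)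
      have hppx : r (p x) = r (p (p x)) + 1 := (hp _ hpv).2
      have hcard : ({x, y, p (p x)} : Finset V).card = 3 := by
        rw [Finset.card_eq_three]
        refine ⟨x, y, p (p x), hxy, ?_, ?_, rfl⟩
        · intro h; rw [← h] at hppx; omega
        · intro h; rw [← h] at hppx; omega
      rw [← hcard, ← Set.ncard_coe_finset]
      refine Set.ncard_le_ncard ?_ (Set.toFinite _)
      intro z hz
      simp only [Finset.coe_insert, Finset.coe_singleton, Set.mem_insert_iff,
        Set.mem_singleton_iff] at hz
      rcases hz with rfl | rfl | rfl
      · exact (hp _ hxv).1.symm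
      · rw [hpp]; exact (hp _ hyv).1.symm
      · exact (hp _ hpv).1
  have upper : ∀ m x y, r x ≠ 0 → r y = r x + m → leg x = leg y → G.dist x y ≤ m := by
    intro m
    induction m with
    | zero =>
      intro x y hx hy h
      rw [same (r x - 1) x y (by omega) (by omega) h]; simp
    | succ m ih =>
      intro x y hx hy h
      have hyv : y ≠ v := fun h => by have := (hr0 y).2 h; omega
      have hpy : r y = r (p y) + 1 := (hp y hyv).2
      have h1 := ih x (p y) hx (by omega) (by rw [leg_par y (by omega), h])
      have h2 : G.dist x y ≤ G.dist x (p y) + G.dist (p y) y := hc.dist_triangle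
      rw [SimpleGraph.dist_eq_one_iff_adj.2 (hp y hyv).1.symm] at h2
      omega
  have lower : ∀ x y, leg x ≠ leg y → ∀ q : G.Walk x y, r x + r y ≤ q.length := by
    intro x y hxy q
    induction q with
    | nil => exact absurd rfl hxy
    | @cons x c y h q ih =>
      rw [SimpleGraph.Walk.length_cons]
      by_cases hx : x = v
      · have := (hr0 x).2 hx
        have h2 := G.dist_le (SimpleGraph.Walk.cons h q)
        rw [SimpleGraph.Walk.length_cons, hx] at h2
        change r y ≤ _ at h2
        omega
      · by_cases hcv : c = v
        · have h2 := G.dist_le q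
          rw [show G.dist c y = r y by rw [hcv]] at h2
          have h3 : r x = 1 := SimpleGraph.dist_eq_one_iff_adj.2 (hcv ▸ h.symm)
          omega
        · have hl := leg_adj x c h hx hcv
          have h2 := ih (by rwa [← hl])
          have h3 : r x ≤ r c + G.dist c x := hc.dist_triangle
          rw [SimpleGraph.dist_eq_one_iff_adj.2 h.symm] at h3
          omega
  refine ⟨leg, fun x y => ?_⟩
  change G.dist x y = if leg x = leg y then (r x - r y) + (r y - r x) else r x + r y
  have t1 : r x ≤ r y + G.dist y x := hc.dist_triangle
  have t2 : r y ≤ r x + G.dist x y := hc.dist_triangle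
  have t3 : G.dist x y ≤ G.dist x v + r y := hc.dist_triangle
  have t4 : G.dist x v = r x := G.dist_comm
  have t5 : G.dist y x = G.dist x y := G.dist_comm
  split_ifs with h
  · by_cases hx : r x = 0
    · omega
    by_cases hy : r y = 0
    · omega
    rcases le_total (r x) (r y) with hle | hle
    · have := upper (r y - r x) x y hx (by omega) h
      omega
    · have := upper (r x - r y) y x hy (by omega) h.symm
      omega
  · obtain ⟨q, hq⟩ := hc.exists_walk_length_eq_dist x y
    have := lower x y h q
    omega

end Coordinates

section Schedules

variable {V : Type*} {G : SimpleGraph V}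

/-- The slide `p` may be made before the slide `q`: no vertex on the path of `p` is equal or
adjacent to the source of `q`, and none on the path of `q` is equal or adjacent to the target
of `p`. -/
def Precedes (G : SimpleGraph V) (p q : V × V) : Prop :=
  (∀ z, G.dist p.1 z + G.dist z p.2 = G.dist p.1 p.2 → 2 ≤ G.dist z q.1) ∧
  (∀ z, G.dist q.1 z + G.dist z q.2 = G.dist q.1 q.2 → 2 ≤ G.dist z p.2)

lemma exists_bijOn_erase [DecidableEq V] {I J : Finset V} {a b : V} (ha : a ∈ I) (hb : b ∈ J)
    (hex : ∀ x ∈ I.erase a, ∀ y ∈ J.erase b,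
      G.dist a b + G.dist x y ≤ G.dist a y + G.dist x b)
    {g : V → V} (hg : Set.BijOn g I J) :
    ∃ g' : V → V, Set.BijOn g' (I.erase a : Finset V) (J.erase b : Finset V) ∧
      G.dist a b + ∑ u ∈ I.erase a, G.dist u (g' u) ≤ ∑ u ∈ I, G.dist u (g u) := by
  refine ⟨Equiv.swap b (g a) ∘ g, ?_, ?_⟩
  · have h1 : Set.BijOn (Equiv.swap b (g a)) (J : Set V) J := by
      have hga : g a ∈ J := hg.mapsTo ha
      refine ⟨fun x hx => ?_, (Equiv.injective _).injOn, fun x hx => ?_⟩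
      · rw [Equiv.swap_apply_def]
        split_ifs <;> assumption
      · refine ⟨Equiv.swap b (g a) x, ?_, Equiv.swap_apply_self _ _ _⟩
        rw [Equiv.swap_apply_def]
        split_ifs <;> assumption
    have h2 := (h1.comp hg).sdiff_singleton (a := a) ha
    simpa [Finset.coe_erase] using h2
  · rw [← Finset.add_sum_erase I _ ha]
    by_cases hab : g a = b
    · simp [hab]
    obtain ⟨x, hx, hxb⟩ := hg.surjOn hb
    have hxa : x ≠ a := by rintro rfl; exact hab hxb
    have hxI : x ∈ I.erase a := Finset.mem_erase.2 ⟨hxa, hx⟩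
    rw [← Finset.add_sum_erase _ _ hxI, ← Finset.add_sum_erase _ (fun u => G.dist u (g u)) hxI]
    have hrest : ∑ u ∈ (I.erase a).erase x, G.dist u (Equiv.swap b (g a) (g u)) =
        ∑ u ∈ (I.erase a).erase x, G.dist u (g u) := by
      refine Finset.sum_congr rfl fun u hu => ?_
      simp only [Finset.mem_erase] at hu
      rw [Equiv.swap_apply_of_ne_of_ne]
      · rw [← hxb]; exact fun h => hu.1 (hg.injOn hu.2.2 hx h)
      · exact fun h => hu.2.1 (hg.injOn hu.2.2 ha h)
    have := hex x hxI (g a) (Finset.mem_erase.2 ⟨hab, hg.mapsTo ha⟩)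
    simp only [Function.comp_apply]
    rw [hrest, hxb, Equiv.swap_apply_left]
    omega

/-- The list `l` of source-target pairs slides the tokens on `I` to `J`, one after the other and
with minimum total distance. -/
structure IsSchedule [DecidableEq V] (G : SimpleGraph V) (I J : Finset V) (l : List (V × V)) :
    Prop where
  nodup_fst : (l.map Prod.fst).Nodup
  nodup_snd : (l.map Prod.snd).Nodup
  mem_fst : ∀ x, x ∈ l.map Prod.fst ↔ x ∈ I
  mem_snd : ∀ x, x ∈ l.map Prod.snd ↔ x ∈ J
  precedes : l.Pairwise (Precedes G)
  sum_le : ∀ g : V → V, Set.BijOn g I J →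
    (l.map fun p => G.dist p.1 p.2).sum ≤ ∑ u ∈ I, G.dist u (g u)

lemma IsSchedule.insert [DecidableEq V] {I J : Finset V} {a b : V} {l : List (V × V)}
    (h : IsSchedule G (I.erase a) (J.erase b) l) (ha : a ∈ I) (hb : b ∈ J)
    (hex : ∀ x ∈ I.erase a, ∀ y ∈ J.erase b,
      G.dist a b + G.dist x y ≤ G.dist a y + G.dist x b)
    (hprec : (∀ x ∈ I.erase a, ∀ y ∈ J.erase b, Precedes G (a, b) (x, y)) ∨
      ∀ x ∈ I.erase a, ∀ y ∈ J.erase b, Precedes G (x, y) (a, b)) :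
    ∃ l', IsSchedule G I J l' := by
  have hmem : ∀ q ∈ l, q.1 ∈ I.erase a ∧ q.2 ∈ J.erase b := fun q hq =>
    ⟨(h.mem_fst _).1 (List.mem_map_of_mem hq), (h.mem_snd _).1 (List.mem_map_of_mem hq)⟩
  have hsum : ∀ g : V → V, Set.BijOn g I J →
      G.dist a b + (l.map fun p => G.dist p.1 p.2).sum ≤ ∑ u ∈ I, G.dist u (g u) := by
    intro g hg
    obtain ⟨g', hg', hle⟩ := exists_bijOn_erase ha hb hex hg
    have := h.sum_le g' hg'
    omega
  have ha' : a ∉ l.map Prod.fst := by rw [h.mem_fst]; simp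
  have hb' : b ∉ l.map Prod.snd := by rw [h.mem_snd]; simp
  have hI : ∀ x, (x = a ∨ x ∈ l.map Prod.fst) ↔ x ∈ I := by
    intro x; rw [h.mem_fst]; grind
  have hJ : ∀ x, (x = b ∨ x ∈ l.map Prod.snd) ↔ x ∈ J := by
    intro x; rw [h.mem_snd]; grind
  rcases hprec with hp | hp
  · refine ⟨(a, b) :: l, ?_, ?_, ?_, ?_, ?_, ?_⟩
    · simpa using ⟨by simpa using ha', h.nodup_fst⟩
    · simpa using ⟨by simpa using hb', h.nodup_snd⟩
    · intro x; rw [← hI]; simp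
    · intro x; rw [← hJ]; simp
    · exact List.pairwise_cons.2 ⟨fun q hq => hp _ (hmem q hq).1 _ (hmem q hq).2, h.precedes⟩
    · intro g hg; simpa using hsum g hg
  · refine ⟨l ++ [(a, b)], ?_, ?_, ?_, ?_, ?_, ?_⟩
    · rw [List.map_append, List.map_singleton, List.nodup_append_comm, List.singleton_append,
        List.nodup_cons]
      exact ⟨ha', h.nodup_fst⟩
    · rw [List.map_append, List.map_singleton, List.nodup_append_comm, List.singleton_append,
        List.nodup_cons]
      exact ⟨hb', h.nodup_snd⟩
    · intro x; rw [← hI, or_comm]; simp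
    · intro x; rw [← hJ, or_comm]; simp
    · refine List.pairwise_append.2 ⟨h.precedes, List.pairwise_singleton _ _, ?_⟩
      intro q hq p hp'
      rw [List.mem_singleton.1 hp']
      exact hp _ (hmem q hq).1 _ (hmem q hq).2
    · intro g hg
      have := hsum g hg
      simp only [List.map_append, List.map_singleton, List.sum_append, List.sum_singleton]
      omega

lemma precedes_of_same_leg [DecidableEq V] {leg : V → V} {r : V → ℕ}
    (hd : ∀ x y, G.dist x y =
      if leg x = leg y then (r x - r y) + (r y - r x) else r x + r y)
    {a b x y : V} (hab : leg b = leg a) (ha : 2 ≤ r a) (hb : 2 ≤ r b)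
    (hx : leg x = leg a → r x + 2 ≤ r a) (hy : leg y = leg a → r y + 2 ≤ r b) :
    (r a ≤ r b → Precedes G (a, b) (x, y)) ∧ (r b < r a → Precedes G (x, y) (a, b)) := by
  refine ⟨fun h => ⟨fun z hz => ?_, fun z hz => ?_⟩, fun h => ⟨fun z hz => ?_, fun z hz => ?_⟩⟩
  all_goals
    simp only [hd, hab] at hz ⊢
    grind

lemma precedes_of_min_max [DecidableEq V] {leg : V → V} {r : V → ℕ}
    (hd : ∀ x y, G.dist x y =
      if leg x = leg y then (r x - r y) + (r y - r x) else r x + r y)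
    {a b x y : V} (hab : leg a = leg b → r a = 0 ∨ r b = 0)
    (hx : 2 ≤ r x) (hxa : leg x = leg a → r a + 2 ≤ r x)
    (hb : 2 ≤ r b) (hyb : leg y = leg b → r y + 2 ≤ r b) (hxb : leg x ≠ leg b) :
    Precedes G (a, b) (x, y) := by
  have h1 : G.dist a b = r a + r b := by
    rw [hd]
    split_ifs with h
    · have := hab h
      omega
    · rfl
  refine ⟨fun z hz => ?_, fun z hz => ?_⟩
  · rw [h1] at hz
    simp only at hz ⊢
    rw [hd z x]
    split_ifs with h
    · have h2 : leg z ≠ leg b := h ▸ hxb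
      rw [hd z b, if_neg h2, hd] at hz
      split_ifs at hz with h3
      · have := hxa (h.symm.trans h3.symm)
        omega
      · omega
    · omega
  · simp only [hd] at hz ⊢
    split_ifs with h
    · rw [h, if_neg hxb] at hz
      by_cases hy : leg b = leg y
      · have := hyb hy.symm
        simp only [hy] at hz hxb
        simp only [hxb, if_true, if_false] at hz
        omega
      · rw [if_neg hy] at hz
        split_ifs at hz <;> omega
    · omega

lemma exists_isSchedule [DecidableEq V] (leg : V → V) (r : V → ℕ)
    (hd : ∀ x y, G.dist x y =
      if leg x = leg y then (r x - r y) + (r y - r x) else r x + r y) :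
    ∀ (n : ℕ) (I J : Finset V), I.card = n → J.card = n →
      (∀ x ∈ I, ∀ y ∈ I, x ≠ y → 2 ≤ G.dist x y) →
      (∀ x ∈ J, ∀ y ∈ J, x ≠ y → 2 ≤ G.dist x y) →
      (∀ x ∈ I, r x ≠ 1) → (∀ x ∈ J, r x ≠ 1) → ∃ l, IsSchedule G I J l := by
  intro n
  induction n with
  | zero =>
    intro I J hIc hJc _ _ _ _
    rw [Finset.card_eq_zero] at hIc hJc
    subst hIc hJc
    exact ⟨[], by constructor <;> simp⟩
  | succ n ih =>
    intro I J hIc hJc hI hJ hI1 hJ1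
    have step : ∀ a ∈ I, ∀ b ∈ J, (∀ x ∈ I.erase a, ∀ y ∈ J.erase b,
          G.dist a b + G.dist x y ≤ G.dist a y + G.dist x b) →
        ((∀ x ∈ I.erase a, ∀ y ∈ J.erase b, Precedes G (a, b) (x, y)) ∨
          ∀ x ∈ I.erase a, ∀ y ∈ J.erase b, Precedes G (x, y) (a, b)) →
        ∃ l, IsSchedule G I J l := by
      intro a ha b hb hex hprec
      obtain ⟨l, hl⟩ := ih (I.erase a) (J.erase b)
        (by rw [Finset.card_erase_of_mem ha, hIc]; rfl)
        (by rw [Finset.card_erase_of_mem hb, hJc]; rfl)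
        (fun x hx y hy => hI x (Finset.mem_of_mem_erase hx) y (Finset.mem_of_mem_erase hy))
        (fun x hx y hy => hJ x (Finset.mem_of_mem_erase hx) y (Finset.mem_of_mem_erase hy))
        (fun x hx => hI1 x (Finset.mem_of_mem_erase hx))
        (fun x hx => hJ1 x (Finset.mem_of_mem_erase hx))
      exact hl.insert ha hb hex hprec
    by_cases hcase : ∃ a ∈ I, ∃ b ∈ J, leg a = leg b ∧ r a ≠ 0 ∧ r b ≠ 0
    · obtain ⟨a₀, ha₀, b₀, hb₀, hl, hra₀, hrb₀⟩ := hcase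
      obtain ⟨a, ha, hamax⟩ := (I.filter (leg · = leg a₀)).exists_max_image r
        ⟨a₀, by simp [ha₀]⟩
      obtain ⟨b, hb, hbmax⟩ := (J.filter (leg · = leg a₀)).exists_max_image r
        ⟨b₀, by simp [hb₀, hl]⟩
      simp only [Finset.mem_filter] at ha hb hamax hbmax
      have hra : 2 ≤ r a := by
        have := hamax a₀ ⟨ha₀, rfl⟩
        have := hI1 a ha.1
        omega
      have hrb : 2 ≤ r b := by
        have := hbmax b₀ ⟨hb₀, hl.symm⟩
        have := hJ1 b hb.1
        omega
      have hIa : ∀ x ∈ I.erase a, leg x = leg a → r x + 2 ≤ r a := by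
        intro x hx hxl
        rw [Finset.mem_erase] at hx
        have h1 := hamax x ⟨hx.2, hxl.trans ha.2⟩
        have h2 := hI x hx.2 a ha.1 hx.1
        rw [hd, if_pos hxl] at h2
        omega
      have hJb : ∀ x ∈ J.erase b, leg x = leg a → r x + 2 ≤ r b := by
        intro x hx hxl
        rw [Finset.mem_erase] at hx
        have h1 := hbmax x ⟨hx.2, hxl.trans ha.2⟩
        have h2 := hJ x hx.2 b hb.1 hx.1
        rw [hd, if_pos (hxl.trans (ha.2.trans hb.2.symm))] at h2
        omega
      have hab : leg b = leg a := hb.2.trans ha.2.symm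
      refine step a ha.1 b hb.1 ?_ ?_
      · intro x hx y hy
        have h1 := hIa x hx
        have h2 := hJb y hy
        simp only [hd, hab]
        grind
      · have hp := fun x hx y hy =>
          precedes_of_same_leg hd hab hra hrb (hIa x hx) (hJb y hy)
        rcases le_or_gt (r a) (r b) with hle | hlt
        · exact Or.inl fun x hx y hy => (hp x hx y hy).1 hle
        · exact Or.inr fun x hx y hy => (hp x hx y hy).2 hlt
    · push Not at hcase
      obtain ⟨a, ha, hamin⟩ := I.exists_min_image r (Finset.card_pos.1 (by omega))
      obtain ⟨b, hb, hbmax⟩ := J.exists_max_image r (Finset.card_pos.1 (by omega))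
      have hIJ : ∀ x ∈ I, ∀ y ∈ J, leg x = leg y → r x = 0 ∨ r y = 0 := by
        intro x hx y hy h
        by_cases h0 : r x = 0
        · exact Or.inl h0
        · exact Or.inr (hcase x hx y hy h h0)
      have hIa : ∀ x ∈ I.erase a, 2 ≤ r x ∧ (leg x = leg a → r a + 2 ≤ r x) := by
        intro x hx
        rw [Finset.mem_erase] at hx
        have h1 := hamin x hx.2
        have h2 := hI x hx.2 a ha hx.1
        have h3 := hI1 x hx.2
        rw [hd] at h2
        grind
      have hJb : ∀ y ∈ J.erase b, 2 ≤ r b ∧ r y ≤ r b ∧ (leg y = leg b → r y + 2 ≤ r b) := by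
        intro y hy
        rw [Finset.mem_erase] at hy
        have h1 := hbmax y hy.2
        have h2 := hJ y hy.2 b hb hy.1
        have h3 := hJ1 b hb
        rw [hd] at h2
        grind
      have hab := hIJ a ha b hb
      refine step a ha b hb ?_ (Or.inl ?_)
      · intro x hx y hy
        have h1 := hIJ x (Finset.mem_of_mem_erase hx) y (Finset.mem_of_mem_erase hy)
        have h2 := hIJ a ha y (Finset.mem_of_mem_erase hy)
        have h3 := hIJ x (Finset.mem_of_mem_erase hx) b hb
        simp only [hd]
        grind
      · intro x hx y hy
        have h1 := hIa x hx
        have h2 := hJb y hy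
        refine precedes_of_min_max hd hab h1.1 h1.2 h2.1 h2.2.2 fun h => ?_
        have := hIJ x (Finset.mem_of_mem_erase hx) b hb h
        omega

end Schedules

section Sliding

variable {V : Type*} [DecidableEq V] {G : SimpleGraph V}

/-- `Slides G A B n`: the tokens on `A` can be moved to `B` by `n` slides through independent
sets. -/
inductive Slides (G : SimpleGraph V) : Finset V → Finset V → ℕ → Prop
  | refl {A : Finset V} : IsIndep G A → Slides G A A 0
  | cons {A B C : Finset V} {n : ℕ} :
      IsIndep G A → Step G A B → Slides G B C n → Slides G A C (n + 1)

lemma Slides.trans {A B C : Finset V} {m n : ℕ} (h₁ : Slides G A B m) (h₂ : Slides G B C n) :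
    Slides G A C (m + n) := by
  induction h₁ with
  | refl _ => simpa using h₂
  | cons hA hs _ ih => rw [Nat.add_right_comm]; exact .cons hA hs (ih h₂)

lemma Step.card_eq {A B : Finset V} (h : Step G A B) : A.card = B.card := by
  obtain ⟨x, y, -, h1, h2⟩ := h
  rw [← Finset.card_sdiff_add_card_inter A B, ← Finset.card_sdiff_add_card_inter B A,
    Finset.inter_comm B A, h1, h2, Finset.card_singleton, Finset.card_singleton]

lemma Slides.exists_isTSSeq {A B : Finset V} {n : ℕ} (h : Slides G A B n) :
    ∃ S, IsTSSeq G A B S ∧ len S = n := by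
  induction h with
  | @refl A hA =>
    exact ⟨[A], ⟨by simp, by simp, by simp, by simpa using hA, List.isChain_singleton _⟩, rfl⟩
  | @cons A B C n hA hs _ ih =>
    obtain ⟨S, ⟨hne, hhead, hlast, hall, hchain⟩, hlen⟩ := ih
    obtain ⟨B', T, rfl⟩ := List.exists_cons_of_ne_nil hne
    obtain rfl : B' = B := by simpa using hhead
    refine ⟨A :: B' :: T, ⟨by simp, by simp, ?_, ?_, ?_⟩, ?_⟩
    · rwa [List.getLast?_cons_cons]
    · intro D hD
      rcases List.mem_cons.1 hD with rfl | hD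
      · exact ⟨hA, rfl⟩
      · rw [hs.card_eq]; exact hall D hD
    · exact List.isChain_cons_cons.2 ⟨hs, hchain⟩
    · simp only [len, List.length_cons] at hlen ⊢
      omega

lemma IsIndep.insert {Q : Finset V} (hQ : IsIndep G Q) {z : V}
    (hz : ∀ q ∈ Q, 2 ≤ G.dist z q) : IsIndep G (insert z Q) := by
  have hadj : ∀ q ∈ Q, ¬ G.Adj z q := fun q hq h => by
    have := hz q hq
    rw [SimpleGraph.dist_eq_one_iff_adj.2 h] at this
    omega
  intro x hx y hy
  rcases Finset.mem_insert.1 hx with rfl | hxQ <;>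
    rcases Finset.mem_insert.1 hy with rfl | hyQ
  · exact G.irrefl
  · exact hadj y hyQ
  · exact fun h => hadj x hxQ h.symm
  · exact hQ x hxQ y hyQ

lemma slides_along_path (hG : G.Connected) {Q : Finset V} (hQ : IsIndep G Q) {b : V} :
    ∀ (n : ℕ) (a : V), G.dist a b = n →
      (∀ z, G.dist a z + G.dist z b = G.dist a b → ∀ q ∈ Q, 2 ≤ G.dist z q) →
      Slides G (insert a Q) (insert b Q) n := by
  intro n
  induction n with
  | zero =>
    intro a hab hz
    obtain rfl := hG.dist_eq_zero_iff.1 hab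
    exact .refl (hQ.insert (hz a (by simp)))
  | succ n ih =>
    intro a hab hz
    obtain ⟨c, hac, hcb⟩ := exists_adj_dist_eq hG hab
    have hac1 := SimpleGraph.dist_eq_one_iff_adj.2 hac
    have hza := hz a (by simp)
    have hzc := hz c (by omega)
    have haQ : a ∉ Q := fun h => by simpa using hza a h
    have hcQ : c ∉ Q := fun h => by simpa using hzc c h
    have hne := hac.ne
    refine .cons (hQ.insert hza) ⟨a, c, hac, ?_, ?_⟩ (ih c hcb fun z h => hz z ?_)
    · grind
    · grind
    · have h1 : G.dist a z ≤ G.dist a c + G.dist c z := hG.dist_triangle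
      have h2 : G.dist a b ≤ G.dist a z + G.dist z b := hG.dist_triangle
      omega

lemma slides_of_pairwise_precedes (hG : G.Connected) :
    ∀ (l : List (V × V)) (P : Finset V), l.Pairwise (Precedes G) →
      (∀ q ∈ l, ∀ z, G.dist q.1 z + G.dist z q.2 = G.dist q.1 q.2 → ∀ p ∈ P, 2 ≤ G.dist z p) →
      IsIndep G (P ∪ (l.map Prod.fst).toFinset) →
      Slides G (P ∪ (l.map Prod.fst).toFinset) (P ∪ (l.map Prod.snd).toFinset)
        (l.map fun p => G.dist p.1 p.2).sum := by
  intro l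
  induction l with
  | nil => intro P _ _ hI; exact .refl (by simpa using hI)
  | cons q l ih =>
    intro P hl hP hI
    rw [List.pairwise_cons] at hl
    set Q := P ∪ (l.map Prod.fst).toFinset with hQdef
    have hsrc : P ∪ ((q :: l).map Prod.fst).toFinset = insert q.1 Q := by
      simp [hQdef, Finset.union_insert]
    have hQ : IsIndep G Q := fun x hx y hy =>
      hI x (hsrc ▸ Finset.mem_insert_of_mem hx) y (hsrc ▸ Finset.mem_insert_of_mem hy)
    have hz : ∀ z, G.dist q.1 z + G.dist z q.2 = G.dist q.1 q.2 → ∀ p ∈ Q, 2 ≤ G.dist z p := by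
      intro z hz p hp
      rcases Finset.mem_union.1 hp with hp | hp
      · exact hP q (by simp) z hz p hp
      · obtain ⟨s, hs, rfl⟩ := List.mem_map.1 (List.mem_toFinset.1 hp)
        exact (hl.1 s hs).1 z hz
    have hfirst := slides_along_path hG hQ _ q.1 rfl hz
    have hQ' : insert q.2 Q = insert q.2 P ∪ (l.map Prod.fst).toFinset := by
      rw [Finset.insert_union]
    have hrest := ih (insert q.2 P) hl.2 (fun s hs z hz p hp => by
        rcases Finset.mem_insert.1 hp with rfl | hp
        · exact (hl.1 s hs).2 z hz
        · exact hP s (List.mem_cons_of_mem _ hs) z hz p hp)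
      (hQ' ▸ hQ.insert (hz q.2 (by simp)))
    have htgt : P ∪ ((q :: l).map Prod.snd).toFinset =
        insert q.2 P ∪ (l.map Prod.snd).toFinset := by
      simp [Finset.union_insert, Finset.insert_union]
    rw [hsrc, htgt, List.map_cons, List.sum_cons]
    exact hfirst.trans (hQ' ▸ hrest)

lemma eq_Mstar_of_forall_le [Fintype V] {I J : Finset V} {f : V → V} (hf : Set.BijOn f I J)
    (hmin : ∀ g : V → V, Set.BijOn g I J →
      ∑ u ∈ I, G.dist u (f u) ≤ ∑ u ∈ I, G.dist u (g u)) :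
    ∑ u ∈ I, G.dist u (f u) = Mstar G I J := by
  have hmem : ∑ u ∈ I, G.dist u (f u) ∈ { m : ℕ | ∃ e : {x // x ∈ I} ≃ {y // y ∈ J},
      m = ∑ x : {x // x ∈ I}, G.dist (x : V) ((e x : V)) } :=
    ⟨hf.equiv, (Finset.sum_coe_sort I fun u => G.dist u (f u)).symm⟩
  refine le_antisymm (le_csInf ⟨_, hmem⟩ ?_) (Nat.sInf_le hmem)
  rintro m ⟨e, rfl⟩
  let g : V → V := fun x => if h : x ∈ I then e ⟨x, h⟩ else x
  have hg : ∀ x : {x // x ∈ I}, g x = e x := fun x => dif_pos x.2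
  have hbij : Set.BijOn g I J := by
    refine ⟨fun x hx => ?_, fun x hx y hy h => ?_, fun y hy => ?_⟩
    · rw [hg ⟨x, hx⟩]; exact (e ⟨x, hx⟩).2
    · rw [hg ⟨x, hx⟩, hg ⟨y, hy⟩] at h
      exact congrArg Subtype.val (e.injective (Subtype.ext h))
    · refine ⟨e.symm ⟨y, hy⟩, (e.symm ⟨y, hy⟩).2, ?_⟩
      rw [hg, e.apply_symm_apply]
  refine (hmin g hbij).trans_eq ?_
  rw [← Finset.sum_coe_sort]
  exact Finset.sum_congr rfl fun x _ => by rw [hg]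

end Sliding

/-- Lemma 4 of the paper, constructive form. If no token of
`I` or `J` is adjacent to the body `v` and some leg has `|I_L| ≠ |J_L|`, then
there are an optimal target assignment `f` and an ordering `w_1, …, w_k` of `I`
such that each token in turn can be slid directly to its target along the unique
path (all intermediate vertex sets being independent), and the concatenation of
these direct slides is a TS-sequence between `I` and `J` of length `M*(G,I,J)`.
(A vertex `z` lies on the unique `u`–`u'` path of the tree `G` iff
`dist(u,z) + dist(z,u') = dist(u,u')`.) -/
theorem spider_direct_sliding_order
    {V : Type*} [Fintype V] [DecidableEq V] (G : SimpleGraph V) (v : V)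
    (hG : IsSpider G v) (I J : Finset V)
    (hI : IsIndep G I) (hJ : IsIndep G J) (hcard : I.card = J.card)
    (hreconf : Reconf G I J)
    (hIrigid : ∀ u ∈ I, ¬ RigidToken G I u)
    (hJrigid : ∀ u ∈ J, ¬ RigidToken G J u)
    (hIN : (I : Set V) ∩ G.neighborSet v = ∅)
    (hJN : (J : Set V) ∩ G.neighborSet v = ∅)
    (w₁ : V) (hw₁ : IsFirstLeg G I J v w₁)
    (hleg : ∃ w, G.Adj v w ∧ ILegCard G I v w₁ w ≠ ILegCard G J v w₁ w) :
    ∃ (f : V → V) (w : Fin I.card → V),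
      Set.BijOn f (I : Set V) (J : Set V) ∧
      Function.Injective w ∧ Finset.image w Finset.univ = I ∧
      (∑ u ∈ I, G.dist u (f u)) = Mstar G I J ∧
      (∀ i : Fin I.card, ∀ z : V,
        G.dist (w i) z + G.dist z (f (w i)) = G.dist (w i) (f (w i)) →
        IsIndep G (insert z ((config f w (i : ℕ)) \ {w i}))) ∧
      (∃ S, IsTSSeq G I J S ∧ len S = Mstar G I J) := by
  have hc := hG.1.connected
  obtain ⟨leg, hd⟩ := exists_coordinates hG.1 v hG.2.2
  have two_le : ∀ {A : Finset V}, IsIndep G A → ∀ x ∈ A, ∀ y ∈ A, x ≠ y → 2 ≤ G.dist x y :=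
    fun hA x hx y hy hxy => hc.one_lt_dist_of_ne_of_not_adj hxy (hA x hx y hy)
  have ne_one : ∀ {A : Finset V}, (A : Set V) ∩ G.neighborSet v = ∅ →
      ∀ x ∈ A, G.dist v x ≠ 1 := fun hA x hx h =>
    (hA ▸ Set.mem_inter hx (SimpleGraph.dist_eq_one_iff_adj.1 h) : x ∈ (∅ : Set V))
  obtain ⟨l, hl⟩ := exists_isSchedule leg (G.dist v) hd _ I J rfl hcard.symm (two_le hI)
    (two_le hJ) (ne_one hIN) (ne_one hJN)
  have hsrc : (l.map Prod.fst).toFinset = I := by ext x; rw [List.mem_toFinset, hl.mem_fst]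
  have htgt : (l.map Prod.snd).toFinset = J := by ext x; rw [List.mem_toFinset, hl.mem_snd]
  have hlen : l.length = I.card := by
    rw [← hsrc, List.toFinset_card_of_nodup hl.nodup_fst, List.length_map]
  have hinj_fst : ∀ p ∈ l, ∀ q ∈ l, p.1 = q.1 → p = q := fun p hp q hq h =>
    List.inj_on_of_nodup_map hl.nodup_fst hp hq h
  have hinj_snd : ∀ p ∈ l, ∀ q ∈ l, p.2 = q.2 → p = q := fun p hp q hq h =>
    List.inj_on_of_nodup_map hl.nodup_snd hp hq h
  have hfun : ∀ u, ∃ t, ∀ p ∈ l, p.1 = u → p.2 = t := fun u => by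
    by_cases h : ∃ p ∈ l, p.1 = u
    · obtain ⟨p, hp, rfl⟩ := h
      exact ⟨p.2, fun q hq h => congrArg Prod.snd (hinj_fst q hq p hp h)⟩
    · exact ⟨u, fun p hp hpu => absurd ⟨p, hp, hpu⟩ h⟩
  choose f hf using hfun
  have hf' : ∀ p ∈ l, f p.1 = p.2 := fun p hp => (hf _ p hp rfl).symm
  have hbij : Set.BijOn f I J := by
    refine ⟨fun x hx => ?_, fun x hx y hy h => ?_, fun y hy => ?_⟩
    · obtain ⟨p, hp, rfl⟩ := List.mem_map.1 ((hl.mem_fst x).2 hx)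
      rw [hf' p hp]
      exact (hl.mem_snd _).1 (List.mem_map_of_mem hp)
    · obtain ⟨p, hp, rfl⟩ := List.mem_map.1 ((hl.mem_fst x).2 hx)
      obtain ⟨q, hq, rfl⟩ := List.mem_map.1 ((hl.mem_fst y).2 hy)
      rw [hf' p hp, hf' q hq] at h
      rw [hinj_snd p hp q hq h]
    · obtain ⟨p, hp, rfl⟩ := List.mem_map.1 ((hl.mem_snd y).2 hy)
      exact ⟨p.1, (hl.mem_fst _).1 (List.mem_map_of_mem hp), hf' p hp⟩
  have hsum : (l.map fun p => G.dist p.1 p.2).sum = ∑ u ∈ I, G.dist u (f u) := by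
    rw [← hsrc, List.sum_toFinset _ hl.nodup_fst, List.map_map]
    exact congrArg List.sum (List.map_congr_left fun p hp => by simp [hf' p hp])
  have hM : ∑ u ∈ I, G.dist u (f u) = Mstar G I J :=
    eq_Mstar_of_forall_le hbij fun g hg => hsum ▸ hl.sum_le g hg
  let e : Fin I.card → V × V := fun i => l.get (i.cast hlen.symm)
  have he : ∀ i, e i ∈ l := fun i => List.get_mem _ _
  have hfe : ∀ i, f (e i).1 = (e i).2 := fun i => hf' _ (he i)
  have hprec : ∀ i j, i < j → Precedes G (e i) (e j) := fun i j hij =>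
    List.pairwise_iff_get.1 hl.precedes _ _ hij
  have heinj : Function.Injective fun i => (e i).1 := fun i j h => by
    have h1 := hinj_fst _ (he i) _ (he j) h
    have h2 := (List.Nodup.of_map _ hl.nodup_fst).injective_get h1
    exact Fin.cast_injective _ h2
  refine ⟨f, fun i => (e i).1, hbij, heinj, ?_, hM, ?_, ?_⟩
  · refine Finset.eq_of_subset_of_card_le ?_ ?_
    · intro x hx
      obtain ⟨i, -, rfl⟩ := Finset.mem_image.1 hx
      exact (hl.mem_fst _).1 (List.mem_map_of_mem (he i))
    · rw [Finset.card_image_of_injective _ heinj, Finset.card_univ, Fintype.card_fin]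
  · intro i z hz
    have hsrcI : ∀ t, (e t).1 ∈ I := fun t => (hl.mem_fst _).1 (List.mem_map_of_mem (he t))
    have htgtJ : ∀ t, (e t).2 ∈ J := fun t => (hl.mem_snd _).1 (List.mem_map_of_mem (he t))
    have hconf : ∀ x ∈ config f (fun i => (e i).1) i \ {(e i).1},
        (∃ t, i < t ∧ (e t).1 = x) ∨ ∃ t, t < i ∧ (e t).2 = x := by
      intro x hx
      simp only [config, Finset.mem_sdiff, Finset.mem_union, Finset.mem_image, Finset.mem_filter,
        Finset.mem_univ, true_and, Finset.mem_singleton, hfe] at hx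
      obtain ⟨⟨t, hit, rfl⟩ | ⟨t, hti, rfl⟩, hne⟩ := hx
      · refine Or.inl ⟨t, lt_of_le_of_ne hit ?_, rfl⟩
        rintro rfl
        exact hne rfl
      · exact Or.inr ⟨t, hti, rfl⟩
    have hst : ∀ s t, s < t → ¬ G.Adj (e s).2 (e t).1 := fun s t h hadj => by
      have := (hprec s t h).1 (e s).2 (by simp)
      rw [SimpleGraph.dist_eq_one_iff_adj.2 hadj] at this
      omega
    refine IsIndep.insert ?_ ?_
    · intro x hx y hy
      rcases hconf x hx with ⟨s, hs, rfl⟩ | ⟨s, hs, rfl⟩ <;>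
        rcases hconf y hy with ⟨t, ht, rfl⟩ | ⟨t, ht, rfl⟩
      · exact hI _ (hsrcI s) _ (hsrcI t)
      · exact fun h => hst t s (ht.trans hs) h.symm
      · exact hst s t (hs.trans ht)
      · exact hJ _ (htgtJ s) _ (htgtJ t)
    · intro x hx
      rw [hfe] at hz
      rcases hconf x hx with ⟨t, ht, rfl⟩ | ⟨t, ht, rfl⟩
      · exact (hprec i t ht).1 z hz
      · exact (hprec t i ht).2 z hz
  · have h := slides_of_pairwise_precedes hc l ∅ hl.precedes (by simp) (by simpa [hsrc] using hI)
    rw [hsrc, htgt, Finset.empty_union, Finset.empty_union, hsum, hM] at h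
    exact h.exists_isTSSeq

end SlidingTokenPaper
end
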